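/- For all symmetric Borel probability measures ν₁, ν₂ on the unit sphere Sⁿ ⊂ ℝ^{n+1}, it holds (n+1)·T_α(ν₁,ν₂) ≤ H(ν₁|σ) + H(ν₂|σ), where σ is the uniform probability measure on Sⁿ and α(u,v) = log(1/(u·v)) if u·v > 0 and α(u,v) = +∞ otherwise. -/

import Mathlib

open MeasureTheory Set Filter
open scoped RealInnerProductSpace ENNReal Topology

/-- The set of couplings of two measures: measures on the product whose marginals are the
given measures. -/
def Coupling {α : Type*} [MeasurableSpace α] (ν₁ ν₂ : Measure α) :
    Set (Measure (α × α)) :=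
  {π | π.map Prod.fst = ν₁ ∧ π.map Prod.snd = ν₂}

/-- The optimal transport cost `T_c(ν₁,ν₂) = inf { ∫ c dπ : π coupling of ν₁ and ν₂}`. -/
noncomputable def transportCost {α : Type*} [MeasurableSpace α]
    (c : α → α → ℝ≥0∞) (ν₁ ν₂ : Measure α) : ℝ≥0∞ :=
  ⨅ π ∈ Coupling ν₁ ν₂, ∫⁻ p, c p.1 p.2 ∂π

open Classical in
/-- Relative entropy `H(ν|μ) = ∫ log (dν/dμ) dν` if `ν ≪ μ` (and the integral exists),
`+∞` otherwise.  For probability measures the negative part of the integrand is always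
integrable, so the `+∞` convention for the non-integrable case is the correct one. -/
noncomputable def relEnt {α : Type*} [MeasurableSpace α] (ν μ : Measure α) : ℝ≥0∞ :=
  if ν ≪ μ ∧ Integrable (llr ν μ) ν then ENNReal.ofReal (∫ x, llr ν μ x ∂ν) else ⊤


/-- The Oliker-Bertrand-Kolesnikov cost on the sphere:
`α(u,v) = log(1/(u·v))` if `u·v > 0` and `+∞` otherwise. -/
noncomputable def sphereCost {n : ℕ}
    (u v : EuclideanSpace ℝ (Fin (n + 1))) : ℝ≥0∞ :=
  if 0 < ⟪u, v⟫ then ENNReal.ofReal (Real.log (1 / ⟪u, v⟫)) else ⊤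

theorem volume_add_volume_le_of_midpoint_mem {A B I : Set ℝ} (hA : A.Nonempty) (hB : B.Nonempty)
    (hI : I.OrdConnected) (h : ∀ x ∈ A, ∀ y ∈ B, (x + y) / 2 ∈ I) :
    volume A + volume B ≤ 2 * volume I := by
  have key : ∀ x ∈ A, ∀ x' ∈ A, ∀ y ∈ B, ∀ y' ∈ B,
      edist x x' + edist y y' ≤ 2 * volume I := by
    have main : ∀ x ∈ A, ∀ x' ∈ A, ∀ y ∈ B, ∀ y' ∈ B, x ≤ x' → y ≤ y' →
        edist x x' + edist y y' ≤ 2 * volume I := by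
      intro x hx x' hx' y hy y' hy' h1 h2
      have hsub : Icc ((x + y) / 2) ((x' + y') / 2) ⊆ I := hI.out (h x hx y hy) (h x' hx' y' hy')
      calc edist x x' + edist y y' = ENNReal.ofReal (x' - x) + ENNReal.ofReal (y' - y) := by
            rw [edist_comm x, edist_comm y, edist_dist, edist_dist, Real.dist_eq, Real.dist_eq,
              abs_of_nonneg (by linarith), abs_of_nonneg (by linarith)]
        _ = 2 * ENNReal.ofReal ((x' + y') / 2 - (x + y) / 2) := by
            rw [← ENNReal.ofReal_add (by linarith) (by linarith),
              ← ENNReal.ofReal_ofNat 2, ← ENNReal.ofReal_mul (by norm_num)]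
            congr 1; ring
        _ = 2 * volume (Icc ((x + y) / 2) ((x' + y') / 2)) := by rw [Real.volume_Icc]
        _ ≤ 2 * volume I := by gcongr
    intro x hx x' hx' y hy y' hy'
    rcases le_total x x' with h1 | h1 <;> rcases le_total y y' with h2 | h2
    · exact main x hx x' hx' y hy y' hy' h1 h2
    · rw [edist_comm y]; exact main x hx x' hx' y' hy' y hy h1 h2
    · rw [edist_comm x]; exact main x' hx' x hx y hy y' hy' h1 h2
    · rw [edist_comm x, edist_comm y]; exact main x' hx' x hx y' hy' y hy h1 h2
  obtain ⟨a, ha⟩ := hA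
  obtain ⟨b, hb⟩ := hB
  by_cases hfin : 2 * volume I = ⊤
  · rw [hfin]; exact le_top
  have h2 : ∀ x ∈ A, ∀ x' ∈ A, edist x x' + Metric.ediam B ≤ 2 * volume I := by
    intro x hx x' hx'
    have hne : edist x x' ≠ ⊤ := edist_ne_top _ _
    have hle : edist x x' ≤ 2 * volume I := le_self_add.trans (key x hx x' hx' b hb b hb)
    have : Metric.ediam B ≤ 2 * volume I - edist x x' := by
      refine Metric.ediam_le fun y hy y' hy' => ?_
      exact ENNReal.le_sub_of_add_le_left hne (key x hx x' hx' y hy y' hy')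
    calc _ ≤ edist x x' + (2 * volume I - edist x x') := by gcongr
      _ = _ := add_tsub_cancel_of_le hle
  have hB_top : Metric.ediam B ≠ ⊤ := ne_top_of_le_ne_top hfin (le_add_self.trans (h2 a ha a ha))
  have h3 : Metric.ediam A + Metric.ediam B ≤ 2 * volume I := by
    have hle : Metric.ediam B ≤ 2 * volume I := le_add_self.trans (h2 a ha a ha)
    have : Metric.ediam A ≤ 2 * volume I - Metric.ediam B :=
      Metric.ediam_le fun x hx x' hx' => ENNReal.le_sub_of_add_le_right hB_top (h2 x hx x' hx')
    calc _ ≤ (2 * volume I - Metric.ediam B) + Metric.ediam B := by gcongr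
      _ = _ := tsub_add_cancel_of_le hle
  exact (add_le_add (Real.volume_le_diam A) (Real.volume_le_diam B)).trans h3

theorem lintegral_add_le_of_midpoint {A B h : ℝ → ℝ} (hA0 : ∀ x, 0 ≤ A x) (hB0 : ∀ x, 0 ≤ B x)
    (hh0 : ∀ x, 0 ≤ h x) (hA : Measurable A) (hB : Measurable B) (hh : Measurable h)
    (hA1 : ∀ x, A x ≤ 1) (hB1 : ∀ x, B x ≤ 1)
    (hAs : ∀ t < 1, ∃ x, t < A x) (hBs : ∀ t < 1, ∃ x, t < B x)
    (hc : ∀ t, OrdConnected {x | t < h x})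
    (hmid : ∀ x y t, t < A x → t < B y → t < h ((x + y) / 2)) :
    (∫⁻ x, ENNReal.ofReal (A x)) + ∫⁻ x, ENNReal.ofReal (B x)
      ≤ 2 * ∫⁻ x, ENNReal.ofReal (h x) := by
  rw [lintegral_eq_lintegral_meas_lt _ (ae_of_all _ hA0) hA.aemeasurable,
    lintegral_eq_lintegral_meas_lt _ (ae_of_all _ hB0) hB.aemeasurable,
    lintegral_eq_lintegral_meas_lt _ (ae_of_all _ hh0) hh.aemeasurable]
  have hm : Measurable fun t : ℝ => volume {x | t < h x} :=
    Antitone.measurable fun s t hst => measure_mono fun x (hx : t < h x) => hst.trans_lt hx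
  have hmA : Measurable fun t : ℝ => volume {x | t < A x} :=
    Antitone.measurable fun s t hst => measure_mono fun x (hx : t < A x) => hst.trans_lt hx
  rw [← lintegral_add_left hmA, ← lintegral_const_mul _ hm]
  refine lintegral_mono fun t => ?_
  by_cases ht : t < 1
  · exact volume_add_volume_le_of_midpoint_mem (hAs t ht) (hBs t ht) (hc t)
      fun x hx y hy => hmid x y t hx hy
  · have e1 : {x | t < A x} = ∅ := by
      ext x; simpa using (hA1 x).trans (not_lt.1 ht)
    have e2 : {x | t < B x} = ∅ := by
      ext x; simpa using (hB1 x).trans (not_lt.1 ht)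
    simp [e1, e2]

theorem lintegral_mul_le_of_midpoint_of_bddAbove {A B h : ℝ → ℝ} (hA0 : ∀ x, 0 ≤ A x)
    (hB0 : ∀ x, 0 ≤ B x) (hh0 : ∀ x, 0 ≤ h x) (hA : Measurable A) (hB : Measurable B)
    (hh : Measurable h) (hA1 : BddAbove (range A)) (hB1 : BddAbove (range B))
    (hc : ∀ t, OrdConnected {x | t < h x})
    (hmid : ∀ x y, A x * B y ≤ h ((x + y) / 2) ^ 2) :
    (∫⁻ x, ENNReal.ofReal (A x)) * ∫⁻ x, ENNReal.ofReal (B x)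
      ≤ (∫⁻ x, ENNReal.ofReal (h x)) ^ 2 := by
  set α := ⨆ x, A x
  set β := ⨆ x, B x
  have hAα : ∀ x, A x ≤ α := le_ciSup hA1
  have hBβ : ∀ x, B x ≤ β := le_ciSup hB1
  rcases ((hA0 0).trans (hAα 0)).eq_or_lt with hα | hα
  · have : ∀ x, A x = 0 := fun x => le_antisymm ((hAα x).trans hα.ge) (hA0 x)
    simp [this]
  rcases ((hB0 0).trans (hBβ 0)).eq_or_lt with hβ | hβ
  · have : ∀ x, B x = 0 := fun x => le_antisymm ((hBβ x).trans hβ.ge) (hB0 x)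
    simp [this]
  set γ := √(α * β)
  have hγ : 0 < γ := Real.sqrt_pos.2 (mul_pos hα hβ)
  have hγ2 : γ ^ 2 = α * β := Real.sq_sqrt (mul_pos hα hβ).le
  have key := lintegral_add_le_of_midpoint (A := fun x => α⁻¹ * A x) (B := fun x => β⁻¹ * B x)
    (h := fun x => γ⁻¹ * h x) (fun x => mul_nonneg (inv_nonneg.2 hα.le) (hA0 x))
    (fun x => mul_nonneg (inv_nonneg.2 hβ.le) (hB0 x))
    (fun x => mul_nonneg (inv_nonneg.2 hγ.le) (hh0 x))
    (hA.const_mul _) (hB.const_mul _) (hh.const_mul _)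
    (fun x => by rw [inv_mul_le_iff₀ hα, mul_one]; exact hAα x)
    (fun x => by rw [inv_mul_le_iff₀ hβ, mul_one]; exact hBβ x)
    (fun t ht => by
      obtain ⟨x, hx⟩ := exists_lt_of_lt_ciSup (show α * t < ⨆ x, A x by
        change α * t < α; nlinarith)
      exact ⟨x, by rwa [lt_inv_mul_iff₀ hα]⟩)
    (fun t ht => by
      obtain ⟨x, hx⟩ := exists_lt_of_lt_ciSup (show β * t < ⨆ x, B x by
        change β * t < β; nlinarith)
      exact ⟨x, by rwa [lt_inv_mul_iff₀ hβ]⟩)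
    (fun t => by
      have := hc (γ * t)
      simpa only [lt_inv_mul_iff₀ hγ] using this)
    (fun x y t h1 h2 => by
      rw [lt_inv_mul_iff₀ hα] at h1
      rw [lt_inv_mul_iff₀ hβ] at h2
      rw [lt_inv_mul_iff₀ hγ]
      have hm := hmid x y
      rcases lt_or_ge t 0 with ht | ht
      · exact (mul_neg_of_pos_of_neg hγ ht).trans_le (hh0 _)
      · refine lt_of_pow_lt_pow_left₀ 2 (hh0 _) (lt_of_lt_of_le ?_ hm)
        calc (γ * t) ^ 2 = (α * t) * (β * t) := by rw [mul_pow, hγ2]; ring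
          _ < A x * B y := mul_lt_mul'' h1 h2 (by positivity) (by positivity))
  simp only [ENNReal.ofReal_mul (inv_nonneg.2 hα.le), ENNReal.ofReal_mul (inv_nonneg.2 hβ.le),
    ENNReal.ofReal_mul (inv_nonneg.2 hγ.le)] at key
  rw [lintegral_const_mul _ hA.ennreal_ofReal, lintegral_const_mul _ hB.ennreal_ofReal,
    lintegral_const_mul _ hh.ennreal_ofReal] at key
  generalize (∫⁻ x, ENNReal.ofReal (A x)) = X at *
  generalize (∫⁻ x, ENNReal.ofReal (B x)) = Y at *
  generalize (∫⁻ x, ENNReal.ofReal (h x)) = Z at *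
  by_cases hZ : Z = ⊤
  · simp [hZ]
  have hR : 2 * (ENNReal.ofReal γ⁻¹ * Z) ≠ ⊤ := by finiteness
  have hX : X ≠ ⊤ := by
    rintro rfl
    rw [ENNReal.mul_top (by simpa using hα), top_add] at key
    exact hR (top_le_iff.1 key)
  have hY : Y ≠ ⊤ := by
    rintro rfl
    rw [ENNReal.mul_top (by simpa using hβ), add_top] at key
    exact hR (top_le_iff.1 key)
  lift X to NNReal using hX
  lift Y to NNReal using hY
  lift Z to NNReal using hZ
  have key' := ENNReal.toReal_mono hR key
  rw [ENNReal.toReal_add (by finiteness) (by finiteness)] at key'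
  simp only [ENNReal.toReal_mul, ENNReal.toReal_ofReal (inv_nonneg.2 hα.le),
    ENNReal.toReal_ofReal (inv_nonneg.2 hβ.le),
    ENNReal.toReal_ofReal (inv_nonneg.2 hγ.le), ENNReal.coe_toReal, ENNReal.toReal_ofNat] at key'
  have hfin : (X : ℝ) * Y ≤ Z ^ 2 := by
    have hX0 : (0 : ℝ) ≤ X := X.2
    have hY0 : (0 : ℝ) ≤ Y := Y.2
    have hZ0 : (0 : ℝ) ≤ Z := Z.2
    have h1 : 4 * ((α⁻¹ * X) * (β⁻¹ * Y)) ≤ (2 * (γ⁻¹ * Z)) ^ 2 :=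
      calc _ ≤ (α⁻¹ * X + β⁻¹ * Y) ^ 2 := by nlinarith [sq_nonneg (α⁻¹ * X - β⁻¹ * Y)]
        _ ≤ _ := by gcongr
    have h2 : (2 * (γ⁻¹ * Z)) ^ 2 = 4 * ((α * β)⁻¹ * Z ^ 2) := by
      rw [← hγ2]; field_simp; ring
    have h3 : (α⁻¹ * X) * (β⁻¹ * (Y : ℝ)) = (α * β)⁻¹ * (X * Y) := by field_simp
    rw [h2, h3] at h1
    have h4 : (α * β)⁻¹ * ((X : ℝ) * Y) ≤ (α * β)⁻¹ * Z ^ 2 := by linarith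
    exact le_of_mul_le_mul_left h4 (by positivity)
  exact_mod_cast hfin

theorem lintegral_eq_iSup_lintegral_min {X : Type*} [MeasurableSpace X] {μ : Measure X}
    {A : X → ℝ≥0∞} (hA : Measurable A) :
    ∫⁻ x, A x ∂μ = ⨆ k : ℕ, ∫⁻ x, ENNReal.ofReal (min (A x) k).toReal ∂μ := by
  have h1 : ∀ (k : ℕ) x, ENNReal.ofReal (min (A x) k).toReal = min (A x) k := fun k x =>
    ENNReal.ofReal_toReal (by simp)
  simp_rw [h1]
  rw [← lintegral_iSup (fun k => hA.min measurable_const)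
    (fun i j hij x => min_le_min le_rfl (by exact_mod_cast hij))]
  congr with x
  have : ⨆ k : ℕ, min (A x) (k : ℝ≥0∞) = min (A x) (⨆ k : ℕ, (k : ℝ≥0∞)) :=
    (inf_iSup_eq _ _).symm
  rw [this, ENNReal.iSup_natCast, min_top_right]

/-- A one-dimensional Prékopa–Leindler inequality with quasi-concave majorant. -/
theorem lintegral_mul_le_of_midpoint {A B : ℝ → ℝ≥0∞} {h : ℝ → ℝ} (hh0 : ∀ x, 0 ≤ h x)
    (hA : Measurable A) (hB : Measurable B) (hh : Measurable h)
    (hc : ∀ t, OrdConnected {x | t < h x})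
    (hmid : ∀ x y, A x * B y ≤ ENNReal.ofReal (h ((x + y) / 2) ^ 2)) :
    (∫⁻ x, A x) * ∫⁻ x, B x ≤ (∫⁻ x, ENNReal.ofReal (h x)) ^ 2 := by
  rw [lintegral_eq_iSup_lintegral_min hA, lintegral_eq_iSup_lintegral_min hB, ENNReal.iSup_mul]
  refine iSup_le fun k => ?_
  rw [ENNReal.mul_iSup]
  refine iSup_le fun l => ?_
  have hbdd : ∀ (C : ℝ → ℝ≥0∞) (k : ℕ), BddAbove (range fun x => (min (C x) k).toReal) := by
    rintro C k
    refine ⟨k, ?_⟩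
    rintro _ ⟨x, rfl⟩
    have := ENNReal.toReal_mono (ENNReal.natCast_ne_top k) (min_le_right (C x) k)
    simpa using this
  refine lintegral_mul_le_of_midpoint_of_bddAbove (fun _ => ENNReal.toReal_nonneg)
    (fun _ => ENNReal.toReal_nonneg) hh0 (hA.min measurable_const).ennreal_toReal
    (hB.min measurable_const).ennreal_toReal hh (hbdd A k) (hbdd B l) hc fun x y => ?_
  rw [← ENNReal.toReal_mul]
  refine ENNReal.toReal_le_of_le_ofReal (sq_nonneg _) (le_trans ?_ (hmid x y))
  gcongr <;> exact min_le_left _ _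

theorem setLIntegral_Ioi_eq_lintegral_exp (F : ℝ → ℝ≥0∞) :
    ∫⁻ x in Ioi 0, F x = ∫⁻ a, ENNReal.ofReal (Real.exp a) * F (Real.exp a) := by
  have := lintegral_image_eq_lintegral_abs_deriv_mul (s := univ) MeasurableSet.univ
    (fun x _ => (Real.hasDerivAt_exp x).hasDerivWithinAt) Real.exp_injective.injOn F
  simpa [Real.range_exp] using this

theorem lintegral_exp_sub_exp :
    ∫⁻ a, ENNReal.ofReal (Real.exp (a - Real.exp (2 * a) / 2)) =
      ENNReal.ofReal √(Real.pi / 2) := by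
  have h1 := setLIntegral_Ioi_eq_lintegral_exp
    (fun u => ENNReal.ofReal (Real.exp (-(1 / 2) * u ^ 2)))
  have h2 : ∫⁻ u in Ioi (0 : ℝ), ENNReal.ofReal (Real.exp (-(1 / 2) * u ^ 2)) =
      ENNReal.ofReal √(Real.pi / 2) := by
    rw [← ofReal_integral_eq_lintegral_ofReal
      (integrable_exp_neg_mul_sq (by norm_num)).integrableOn (ae_of_all _ fun _ => by positivity),
      integral_gaussian_Ioi]
    congr 1
    rw [show Real.pi / (1 / 2) = 2 ^ 2 * (Real.pi / 2) by ring,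
      Real.sqrt_mul (by norm_num), Real.sqrt_sq (by norm_num)]
    ring
  rw [← h2, h1]
  congr with a
  rw [← ENNReal.ofReal_mul (by positivity), ← Real.exp_add, ← Real.exp_nat_mul]
  congr 2
  push_cast
  ring

theorem ordConnected_lt_exp_sub_exp (c t : ℝ) (hc : 0 ≤ c) :
    OrdConnected {a | t < c * Real.exp (a - Real.exp (2 * a) / 2)} := by
  have hconc : ConcaveOn ℝ univ fun a : ℝ => a - Real.exp (2 * a) / 2 := by
    have h1 : ConvexOn ℝ univ fun a : ℝ => Real.exp (2 * a) :=
      convexOn_exp.comp_linearMap (LinearMap.mulLeft ℝ (2 : ℝ))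
    have h2 : ConvexOn ℝ univ fun a : ℝ => Real.exp (2 * a) / 2 := by
      simpa [div_eq_inv_mul] using h1.smul (show (0 : ℝ) ≤ 2⁻¹ by norm_num)
    exact (concaveOn_id convex_univ).sub h2
  refine ⟨fun x hx z hz y hy => ?_⟩
  have h := hconc.min_le_of_mem_Icc (mem_univ x) (mem_univ z) hy
  simp only [mem_ofPred_eq] at *
  rcases min_le_iff.1 h with h | h
  · exact hx.trans_le (by gcongr)
  · exact hz.trans_le (by gcongr)

theorem setLIntegral_mul_le_of_le_exp {F G : ℝ → ℝ≥0∞} (hF : Measurable F) (hG : Measurable G)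
    {K : ℝ} (hK : 0 ≤ K)
    (h : ∀ s t, 0 < s → 0 < t → F s * G t ≤ ENNReal.ofReal (K * Real.exp (-(s * t)))) :
    (∫⁻ s in Ioi 0, F s) * ∫⁻ t in Ioi 0, G t ≤ ENNReal.ofReal (Real.pi / 2 * K) := by
  rw [setLIntegral_Ioi_eq_lintegral_exp, setLIntegral_Ioi_eq_lintegral_exp]
  refine (lintegral_mul_le_of_midpoint (h := fun a => √K * Real.exp (a - Real.exp (2 * a) / 2))
    (fun _ => by positivity) (by fun_prop) (by fun_prop) (by fun_prop)
    (fun t => ordConnected_lt_exp_sub_exp _ t (by positivity)) fun x y => ?_).trans_eq ?_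
  · calc _ = ENNReal.ofReal (Real.exp x * Real.exp y) * (F (Real.exp x) * G (Real.exp y)) := by
          rw [ENNReal.ofReal_mul (by positivity)]; ring
      _ ≤ ENNReal.ofReal (Real.exp x * Real.exp y) *
          ENNReal.ofReal (K * Real.exp (-(Real.exp x * Real.exp y))) := by
          gcongr; exact h _ _ (Real.exp_pos _) (Real.exp_pos _)
      _ = _ := by
          rw [← ENNReal.ofReal_mul (by positivity), mul_pow, Real.sq_sqrt hK]
          congr 1
          rw [mul_left_comm, ← Real.exp_add, ← Real.exp_add, ← Real.exp_nat_mul]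
          congr 2
          push_cast
          rw [show 2 * ((x + y) / 2) = x + y by ring]
          ring
  · simp_rw [ENNReal.ofReal_mul (Real.sqrt_nonneg K)]
    rw [lintegral_const_mul _ (by fun_prop), lintegral_exp_sub_exp, mul_pow,
      ← ENNReal.ofReal_pow (by positivity), ← ENNReal.ofReal_pow (by positivity),
      Real.sq_sqrt hK, Real.sq_sqrt (by positivity), mul_comm,
      ENNReal.ofReal_mul (by positivity)]

/-- Nonnegative bounded measurable functions with bounded support. -/
structure IsTame {E : Type*} [NormedAddCommGroup E] [MeasurableSpace E] (f : E → ℝ) : Prop where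
  measurable : Measurable f
  nonneg : ∀ x, 0 ≤ f x
  exists_bound : ∃ R, ∀ x, f x ≤ R ∧ (f x ≠ 0 → ‖x‖ ≤ R)

theorem IsTame.comp {E F : Type*} [NormedAddCommGroup E] [MeasurableSpace E]
    [NormedAddCommGroup F] [MeasurableSpace F] {f : F → ℝ} (hf : IsTame f) {T : E → F}
    (hT : Measurable T) {C : ℝ} (hC : 0 ≤ C) (h : ∀ x, ‖x‖ ≤ C * (‖T x‖ + 1)) :
    IsTame fun x => f (T x) := by
  obtain ⟨R, hR⟩ := hf.exists_bound
  refine ⟨hf.measurable.comp hT, fun x => hf.nonneg _, max R (C * (R + 1)), fun x => ⟨?_, ?_⟩⟩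
  · exact (hR _).1.trans (le_max_left _ _)
  · intro hx
    refine (h x).trans (le_trans ?_ (le_max_right _ _))
    gcongr
    exact (hR _).2 hx

theorem IsTame.integrable_mul {E : Type*} [NormedAddCommGroup E] [MeasurableSpace E]
    [BorelSpace E] [ProperSpace E] {μ : Measure E} [IsFiniteMeasureOnCompacts μ] {f : E → ℝ}
    (hf : IsTame f) {h : E → ℝ} (hh : Continuous h) : Integrable (fun x => h x * f x) μ := by
  obtain ⟨R, hR⟩ := hf.exists_bound
  obtain ⟨C, hC⟩ := (isCompact_closedBall (0 : E) R).exists_bound_of_continuousOn hh.continuousOn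
  rw [← integrableOn_iff_integrable_of_support_subset (s := Metric.closedBall 0 R)]
  · refine Measure.integrableOn_of_bounded (M := C * R)
      (isCompact_closedBall (0 : E) R).measure_lt_top.ne
      (hh.measurable.mul hf.measurable).aestronglyMeasurable ?_
    refine (ae_restrict_iff' Metric.isClosed_closedBall.measurableSet).2 (ae_of_all _ fun x hx => ?_)
    rw [norm_mul, Real.norm_of_nonneg (hf.nonneg x)]
    exact mul_le_mul (hC x hx) (hR x).1 (hf.nonneg x) ((norm_nonneg _).trans (hC x hx))
  · intro x hx
    simpa using (hR x).2 (right_ne_zero_of_mul hx)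

theorem IsTame.integrable {E : Type*} [NormedAddCommGroup E] [MeasurableSpace E]
    [BorelSpace E] [ProperSpace E] {μ : Measure E} [IsFiniteMeasureOnCompacts μ] {f : E → ℝ}
    (hf : IsTame f) : Integrable f μ := by
  simpa using hf.integrable_mul (μ := μ) (continuous_const (y := (1 : ℝ)))

theorem IsTame.section_left {E F : Type*} [NormedAddCommGroup E] [MeasurableSpace E]
    [NormedAddCommGroup F] [MeasurableSpace F] {f : E × F → ℝ} (hf : IsTame f) (w : F) :
    IsTame fun s => f (s, w) :=
  hf.comp (T := fun s => (s, w)) (by fun_prop) zero_le_one fun s => by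
    rw [one_mul]
    exact (norm_fst_le ((s, w) : E × F)).trans (by linarith)

theorem IsTame.swap {E F : Type*} [NormedAddCommGroup E] [MeasurableSpace E]
    [NormedAddCommGroup F] [MeasurableSpace F] {f : E × F → ℝ} (hf : IsTame f) :
    IsTame fun p : F × E => f p.swap :=
  hf.comp (T := Prod.swap) measurable_swap zero_le_one fun s => by
    rw [one_mul, Prod.norm_def, Prod.norm_def, max_comm]
    simp

theorem IsTame.integral_left {E F : Type*} [NormedAddCommGroup E] [MeasureSpace E] [BorelSpace E]
    [ProperSpace E] [IsFiniteMeasureOnCompacts (volume : Measure E)] [SFinite (volume : Measure E)]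
    [NormedAddCommGroup F] [MeasurableSpace F] {f : E × F → ℝ} (hf : IsTame f) (s : Set E) :
    IsTame fun w => ∫ t in s, f (t, w) := by
  obtain ⟨R, hR⟩ := hf.exists_bound
  refine ⟨(hf.measurable.stronglyMeasurable.integral_prod_left' (μ := volume.restrict s)).measurable,
    fun w => integral_nonneg fun t => hf.nonneg _,
    max R (∫ t, (Metric.closedBall (0 : E) R).indicator (fun _ => R) t),
    fun w => ⟨?_, fun hw => ?_⟩⟩
  · refine le_trans ?_ (le_max_right _ _)
    have h1 : ∫ t in s, f (t, w) ≤ ∫ t, f (t, w) :=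
      setIntegral_le_integral (hf.section_left w).integrable (ae_of_all _ fun t => hf.nonneg _)
    refine h1.trans (integral_mono (hf.section_left w).integrable ?_ fun t => ?_)
    · refine (integrable_indicator_iff Metric.isClosed_closedBall.measurableSet).2 ?_
      exact integrableOn_const (isCompact_closedBall (0 : E) R).measure_lt_top.ne
    · by_cases ht : t ∈ Metric.closedBall (0 : E) R
      · simpa [indicator_of_mem ht] using (hR _).1
      · rw [indicator_of_notMem ht]
        by_contra! hne
        exact ht (by simpa using (norm_fst_le ((t, w) : E × F)).trans ((hR _).2 hne.ne'))
  · refine le_trans ?_ (le_max_left _ _)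
    by_contra! hlt
    refine hw ?_
    have : ∀ t, f (t, w) = 0 := fun t => by
      by_contra hne
      exact hlt.not_ge ((norm_snd_le ((t, w) : E × F)).trans ((hR _).2 hne))
    simp [this]

theorem exists_integral_Ioi_eq_integral_Iio {F : ℝ → ℝ} (hF : IsTame F) :
    ∃ a, ∫ s in Ioi a, F s = ∫ s in Iio a, F s := by
  obtain ⟨R, hR⟩ := hF.exists_bound
  have hI : Integrable F := hF.integrable
  have hcompl : ∀ a, ∫ s in Ioi a, F s = (∫ s, F s) - ∫ s in Iic a, F s := fun a => by
    rw [← integral_add_compl (measurableSet_Iic (a := a)) hI, compl_Iic]; ring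
  have hcont : Continuous fun a => 2 * ∫ s in Iic a, F s := by
    have : ∀ a, ∫ s in Iic a, F s = (∫ s in Iic 0, F s) + ∫ s in (0 : ℝ)..a, F s := fun a => by
      rw [← intervalIntegral.integral_Iic_sub_Iic hI.integrableOn hI.integrableOn]; ring
    refine Continuous.congr (f := fun a => 2 * ((∫ s in Iic 0, F s) + ∫ s in (0 : ℝ)..a, F s)) ?_
      fun a => by rw [this a]
    exact continuous_const.mul (continuous_const.add (intervalIntegral.continuous_primitive
      (fun a b => hI.intervalIntegrable) 0))
  have h0 : ∫ s in Iic (-R - 1), F s = 0 := by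
    refine setIntegral_eq_zero_of_forall_eq_zero fun s (hs : s ≤ -R - 1) => ?_
    by_contra hne
    have := neg_le_of_abs_le ((hR s).2 hne)
    linarith
  have h1 : ∫ s in Ioi R, F s = 0 := by
    refine setIntegral_eq_zero_of_forall_eq_zero fun s (hs : R < s) => ?_
    by_contra hne
    have := le_of_abs_le ((hR s).2 hne)
    linarith
  have h1' : ∫ s in Iic R, F s = ∫ s, F s := by linarith [hcompl R]
  have hm : 0 ≤ ∫ s, F s := integral_nonneg hF.nonneg
  have hrange : (∫ s, F s) ∈ range fun a => 2 * ∫ s in Iic a, F s :=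
    mem_range_of_exists_le_of_exists_ge hcont ⟨-R - 1, by simp only [h0]; linarith⟩
      ⟨R, by simp only [h1']; linarith⟩
  obtain ⟨a, ha⟩ := hrange
  refine ⟨a, ?_⟩
  rw [hcompl, ← integral_Iic_eq_integral_Iio]
  simp only at ha
  linarith

/-- The functional Santaló inequality in dimension `n`, for centered functions. -/
def CenteredSantalo (n : ℕ) : Prop :=
  ∀ (f : (Fin n → ℝ) → ℝ) (g : (Fin n → ℝ) → ℝ≥0∞) (K : ℝ), IsTame f → Measurable g → 0 ≤ K →
    (∀ i, ∫ x, x i * f x = 0) →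
    (∀ x y, ENNReal.ofReal (f x) * g y ≤ ENNReal.ofReal (K * Real.exp (-(x ⬝ᵥ y)))) →
    (∫⁻ x, ENNReal.ofReal (f x)) * ∫⁻ y, g y ≤ ENNReal.ofReal ((2 * Real.pi) ^ n * K)

theorem CenteredSantalo.half {n : ℕ} (H : CenteredSantalo n) {f : ℝ × (Fin n → ℝ) → ℝ}
    {g : ℝ × (Fin n → ℝ) → ℝ≥0∞} {K : ℝ} (hf : IsTame f) (hg : Measurable g) (hK : 0 ≤ K)
    (hbar : ∀ i, ∫ p : ℝ × (Fin n → ℝ), p.2 i * f p ∂((volume.restrict (Ioi 0)).prod volume) = 0)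
    (h : ∀ s t x y, 0 < s → 0 < t →
      ENNReal.ofReal (f (s, x)) * g (t, y) ≤ ENNReal.ofReal (K * Real.exp (-(s * t + x ⬝ᵥ y)))) :
    (∫⁻ p, ENNReal.ofReal (f p) ∂((volume.restrict (Ioi 0)).prod volume)) *
      ∫⁻ p, g p ∂((volume.restrict (Ioi 0)).prod volume) ≤
        ENNReal.ofReal ((2 * Real.pi) ^ n * (Real.pi / 2 * K)) := by
  rw [lintegral_prod_symm' _ hf.measurable.ennreal_ofReal, lintegral_prod_symm' _ hg]
  have e : ∀ w, ∫⁻ s in Ioi 0, ENNReal.ofReal (f (s, w)) =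
      ENNReal.ofReal (∫ s in Ioi 0, f (s, w)) := fun w =>
    (ofReal_integral_eq_lintegral_ofReal (hf.section_left w).integrable.integrableOn
      (ae_of_all _ fun s => hf.nonneg _)).symm
  simp_rw [e]
  refine H _ _ _ (hf.integral_left _) hg.lintegral_prod_left' (by positivity) (fun i => ?_)
    fun x y => ?_
  · refine Eq.trans ?_ (hbar i)
    rw [integral_prod_symm _ (hf.integrable_mul (by fun_prop))]
    simp_rw [integral_const_mul]
  · rw [← e, mul_assoc]
    refine setLIntegral_mul_le_of_le_exp (hf.section_left x).measurable.ennreal_ofReal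
      (hg.comp (by fun_prop)) (by positivity) fun s t hs ht => ?_
    refine (h s t x y hs ht).trans_eq ?_
    rw [mul_assoc, ← Real.exp_add]
    congr 3; ring

theorem prod_Ioi_add_prod_Iio (n : ℕ) :
    (volume.restrict (Ioi (0 : ℝ))).prod (volume : Measure (Fin n → ℝ)) +
      (volume.restrict (Iio (0 : ℝ))).prod volume = volume := by
  rw [← Measure.add_prod, Measure.restrict_congr_set (Iio_ae_eq_Iic (a := (0 : ℝ))),
    ← compl_Ioi, Measure.restrict_add_restrict_compl measurableSet_Ioi]
  rfl

theorem measurePreserving_reflect (n : ℕ) :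
    MeasurePreserving (fun p : ℝ × (Fin n → ℝ) => (-p.1, p.2))
      ((volume.restrict (Ioi 0)).prod volume) ((volume.restrict (Iio 0)).prod volume) := by
  have h := (Measure.measurePreserving_neg (volume : Measure ℝ)).restrict_preimage
    (measurableSet_Iio (a := 0))
  have e : (Neg.neg ⁻¹' Iio (0 : ℝ)) = Ioi 0 := by ext; simp
  rw [e] at h
  exact h.prod (MeasurePreserving.id _)

theorem measurePreserving_shear_snd {n : ℕ} (ρ : Measure ℝ) [SFinite ρ] (c v : Fin n → ℝ) :
    MeasurePreserving (fun p : ℝ × (Fin n → ℝ) => (p.1, (c + p.1 • v) + p.2))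
      (ρ.prod volume) (ρ.prod volume) :=
  (MeasurePreserving.id ρ).skew_product (g := fun s w => (c + s • v) + w) (by fun_prop)
    (ae_of_all _ fun s => (measurePreserving_add_left volume (c + s • v)).map_eq)

theorem measurePreserving_shear_fst {n : ℕ} (v : Fin n → ℝ) :
    MeasurePreserving (fun p : ℝ × (Fin n → ℝ) => (-(v ⬝ᵥ p.2) + p.1, p.2)) := by
  have h := (MeasurePreserving.id (volume : Measure (Fin n → ℝ))).skew_product
    (μc := (volume : Measure ℝ)) (μd := volume) (g := fun y t => -(v ⬝ᵥ y) + t)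
    (by unfold dotProduct; fun_prop)
    (ae_of_all _ fun y => (measurePreserving_add_left volume (-(v ⬝ᵥ y))).map_eq)
  exact Measure.measurePreserving_swap.comp (h.comp Measure.measurePreserving_swap)

theorem MeasureTheory.MeasurePreserving.integral_comp_measurable {X Y : Type*} [MeasurableSpace X]
    [MeasurableSpace Y] {μ : Measure X} {ν : Measure Y} {T : X → Y} (hT : MeasurePreserving T μ ν)
    {F : Y → ℝ} (hF : Measurable F) : ∫ x, F (T x) ∂μ = ∫ y, F y ∂ν := by
  rw [← hT.map_eq, integral_map hT.measurable.aemeasurable hF.aestronglyMeasurable]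

theorem exists_shear_of_integral_eq {n : ℕ} {f : ℝ × (Fin n → ℝ) → ℝ} (hf : IsTame f)
    (hm : ∫ p, f p ∂((volume.restrict (Ioi 0)).prod volume) =
      ∫ p, f p ∂((volume.restrict (Iio 0)).prod volume))
    (hpos : 0 < ∫ p, f p ∂((volume.restrict (Ioi 0)).prod volume)) :
    ∃ c v : Fin n → ℝ, ∀ i,
      ∫ p : ℝ × (Fin n → ℝ), (p.2 i - (c i + p.1 * v i)) * f p ∂((volume.restrict (Ioi 0)).prod volume) = 0 ∧
      ∫ p : ℝ × (Fin n → ℝ), (p.2 i - (c i + p.1 * v i)) * f p ∂((volume.restrict (Iio 0)).prod volume) = 0 := by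
  set μ₁ := (volume.restrict (Ioi (0 : ℝ))).prod (volume : Measure (Fin n → ℝ)) with hμ₁
  set μ₂ := (volume.restrict (Iio (0 : ℝ))).prod (volume : Measure (Fin n → ℝ)) with hμ₂
  have ae₁ : ∀ᵐ p ∂μ₁, 0 < p.1 :=
    Measure.quasiMeasurePreserving_fst.ae (ae_restrict_mem measurableSet_Ioi)
  have ae₂ : ∀ᵐ p ∂μ₂, p.1 < 0 :=
    Measure.quasiMeasurePreserving_fst.ae (ae_restrict_mem measurableSet_Iio)
  have hS₂ : ∫ p, p.1 * f p ∂μ₂ ≤ 0 := by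
    refine integral_nonpos_of_ae ?_
    filter_upwards [ae₂] with p hp
    exact mul_nonpos_of_nonpos_of_nonneg hp.le (hf.nonneg p)
  have hS₁ : 0 < ∫ p, p.1 * f p ∂μ₁ := by
    have h0 : 0 ≤ᵐ[μ₁] fun p => p.1 * f p := by
      filter_upwards [ae₁] with p hp
      exact mul_nonneg hp.le (hf.nonneg p)
    refine (integral_nonneg_of_ae h0).lt_of_ne' fun h => hpos.ne' ?_
    rw [integral_eq_zero_iff_of_nonneg_ae h0 (hf.integrable_mul (by fun_prop))] at h
    refine integral_eq_zero_of_ae ?_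
    filter_upwards [h, ae₁] with p hp hp'
    exact (mul_eq_zero.1 hp).resolve_left hp'.ne'
  set m := ∫ p, f p ∂μ₁ with hm_def
  set S₁ := ∫ p, p.1 * f p ∂μ₁
  set S₂ := ∫ p, p.1 * f p ∂μ₂
  let X₁ : Fin n → ℝ := fun i => ∫ p : ℝ × (Fin n → ℝ), p.2 i * f p ∂μ₁
  let X₂ : Fin n → ℝ := fun i => ∫ p : ℝ × (Fin n → ℝ), p.2 i * f p ∂μ₂
  have hS : S₁ - S₂ ≠ 0 := by linarith
  let v : Fin n → ℝ := fun i => (X₁ i - X₂ i) / (S₁ - S₂)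
  let c : Fin n → ℝ := fun i => (X₁ i - S₁ * v i) / m
  have expand : ∀ (ρ : Measure ℝ) [IsFiniteMeasureOnCompacts ρ] [SigmaFinite ρ] (i : Fin n),
      ∫ p : ℝ × (Fin n → ℝ), (p.2 i - (c i + p.1 * v i)) * f p ∂(ρ.prod volume) =
        (∫ p : ℝ × (Fin n → ℝ), p.2 i * f p ∂(ρ.prod volume)) - c i * (∫ p, f p ∂(ρ.prod volume))
          - v i * ∫ p, p.1 * f p ∂(ρ.prod volume) := by
    intro ρ _ _ i
    rw [← integral_const_mul, ← integral_const_mul, ← integral_sub, ← integral_sub]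
    · congr with p; ring
    · exact (hf.integrable_mul (by fun_prop)).sub (hf.integrable.const_mul _)
    · exact (hf.integrable_mul (by fun_prop)).const_mul _
    · exact hf.integrable_mul (by fun_prop)
    · exact hf.integrable.const_mul _
  have hv : ∀ i, v i * (S₁ - S₂) = X₁ i - X₂ i := fun i => div_mul_cancel₀ _ hS
  have hc : ∀ i, c i * m = X₁ i - S₁ * v i := fun i => div_mul_cancel₀ _ hpos.ne'
  refine ⟨c, v, fun i => ⟨?_, ?_⟩⟩
  · rw [expand]
    change X₁ i - c i * m - v i * S₁ = 0
    linarith [hc i]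
  · rw [expand]
    change X₂ i - c i * (∫ p, f p ∂μ₂) - v i * S₂ = 0
    rw [← hm]
    linarith [hc i, hv i]

theorem IsTame.exists_translate_integral_eq {n : ℕ} {f : ℝ × (Fin n → ℝ) → ℝ} (hf : IsTame f) :
    ∃ a : ℝ, ∫ p, f (a + p.1, p.2) ∂((volume.restrict (Ioi 0)).prod volume) =
      ∫ p, f (a + p.1, p.2) ∂((volume.restrict (Iio 0)).prod volume) := by
  have hF : IsTame fun s => ∫ w, f (s, w) := by
    have := hf.swap.integral_left univ
    simpa using this
  obtain ⟨a, ha⟩ := exists_integral_Ioi_eq_integral_Iio hF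
  refine ⟨a, ?_⟩
  have hcomp : ∀ S : Set ℝ, MeasurableSet S →
      ∫ p, f (a + p.1, p.2) ∂((volume.restrict ((a + ·) ⁻¹' S)).prod volume) =
        ∫ s in S, ∫ w, f (s, w) := by
    intro S hS
    have hmp := (((measurePreserving_add_left (volume : Measure ℝ) a).restrict_preimage hS).prod
      (MeasurePreserving.id (volume : Measure (Fin n → ℝ)))).integral_comp_measurable hf.measurable
    refine Eq.trans hmp ?_
    rw [integral_prod _ hf.integrable]
  have h1 := hcomp (Ioi a) measurableSet_Ioi
  have h2 := hcomp (Iio a) measurableSet_Iio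
  rw [show (a + ·) ⁻¹' Ioi a = Ioi (0 : ℝ) by ext; simp] at h1
  rw [show (a + ·) ⁻¹' Iio a = Iio (0 : ℝ) by ext; simp] at h2
  rw [h1, h2, ha]

theorem lintegral_prod_eq_add {n : ℕ} {g : ℝ × (Fin n → ℝ) → ℝ≥0∞} :
    ∫⁻ p, g p = (∫⁻ p, g p ∂((volume.restrict (Ioi 0)).prod volume)) +
      ∫⁻ p, g p ∂((volume.restrict (Iio 0)).prod volume) := by
  rw [← lintegral_add_measure, prod_Ioi_add_prod_Iio]

theorem CenteredSantalo.of_integral_eq {n : ℕ} (H : CenteredSantalo n)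
    {f : ℝ × (Fin n → ℝ) → ℝ} (hf : IsTame f)
    {g : ℝ × (Fin n → ℝ) → ℝ≥0∞} {K : ℝ} (hg : Measurable g) (hK : 0 ≤ K)
    (hm : ∫ p, f p ∂((volume.restrict (Ioi 0)).prod volume) =
      ∫ p, f p ∂((volume.restrict (Iio 0)).prod volume))
    (hbar₁ : ∀ i, ∫ p : ℝ × (Fin n → ℝ), p.2 i * f p ∂((volume.restrict (Ioi 0)).prod volume) = 0)
    (hbar₂ : ∀ i, ∫ p : ℝ × (Fin n → ℝ), p.2 i * f p ∂((volume.restrict (Iio 0)).prod volume) = 0)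
    (h : ∀ x y : ℝ × (Fin n → ℝ),
      ENNReal.ofReal (f x) * g y ≤ ENNReal.ofReal (K * Real.exp (-(x.1 * y.1 + x.2 ⬝ᵥ y.2)))) :
    (∫⁻ p, ENNReal.ofReal (f p)) * ∫⁻ p, g p ≤ ENNReal.ofReal ((2 * Real.pi) ^ (n + 1) * K) := by
  have h₁ := H.half hf hg hK hbar₁ fun s t x y _ _ => h (s, x) (t, y)
  have hR := measurePreserving_reflect n
  have hfR : IsTame fun p : ℝ × (Fin n → ℝ) => f (-p.1, p.2) :=
    hf.comp (T := fun p : ℝ × (Fin n → ℝ) => (-p.1, p.2)) hR.measurable zero_le_one fun p => by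
      simp [Prod.norm_def]
  have h₂ := H.half hfR (hg.comp hR.measurable) hK
    (fun i => by
      exact (hR.integral_comp_measurable (F := fun p : ℝ × (Fin n → ℝ) => p.2 i * f p)
        (Measurable.mul (by fun_prop) hf.measurable)).trans (hbar₂ i))
    fun s t x y _ _ => (h (-s, x) (-t, y)).trans_eq (by simp)
  have e₁ := hR.lintegral_comp hf.measurable.ennreal_ofReal
  have e₂ := hR.lintegral_comp hg
  simp only [Function.comp_def] at h₂
  rw [e₁, e₂] at h₂
  have e₃ : ∫⁻ p, ENNReal.ofReal (f p) ∂((volume.restrict (Ioi 0)).prod volume) =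
      ∫⁻ p, ENNReal.ofReal (f p) ∂((volume.restrict (Iio 0)).prod volume) := by
    rw [← ofReal_integral_eq_lintegral_ofReal hf.integrable (ae_of_all _ hf.nonneg),
      ← ofReal_integral_eq_lintegral_ofReal hf.integrable (ae_of_all _ hf.nonneg), hm]
  rw [lintegral_prod_eq_add (g := g), lintegral_prod_eq_add (g := fun p => ENNReal.ofReal (f p)),
    e₃, ← two_mul]
  rw [e₃] at h₁
  refine (show _ ≤ 2 * (ENNReal.ofReal ((2 * Real.pi) ^ n * (Real.pi / 2 * K)) +
    ENNReal.ofReal ((2 * Real.pi) ^ n * (Real.pi / 2 * K))) from ?_).trans_eq ?_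
  · rw [mul_assoc, mul_add]
    gcongr
  · rw [← ENNReal.ofReal_add (by positivity) (by positivity), ← ENNReal.ofReal_ofNat 2,
      ← ENNReal.ofReal_mul (by positivity)]
    congr 1; ring

theorem CenteredSantalo.exists_center {n : ℕ} (H : CenteredSantalo n)
    {f : ℝ × (Fin n → ℝ) → ℝ} (hf : IsTame f) :
    ∃ z : ℝ × (Fin n → ℝ), ∀ (g : ℝ × (Fin n → ℝ) → ℝ≥0∞) (K : ℝ), Measurable g → 0 ≤ K →
      (∀ x y : ℝ × (Fin n → ℝ), ENNReal.ofReal (f (z + x)) * g y ≤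
        ENNReal.ofReal (K * Real.exp (-(x.1 * y.1 + x.2 ⬝ᵥ y.2)))) →
      (∫⁻ p, ENNReal.ofReal (f p)) * ∫⁻ p, g p ≤
        ENNReal.ofReal ((2 * Real.pi) ^ (n + 1) * K) := by
  obtain ⟨a, ha⟩ := hf.exists_translate_integral_eq
  have hTa : MeasurePreserving (fun p : ℝ × (Fin n → ℝ) => (a + p.1, p.2)) :=
    (measurePreserving_add_left (volume : Measure ℝ) a).prod (MeasurePreserving.id _)
  have hfa : IsTame fun p : ℝ × (Fin n → ℝ) => f (a + p.1, p.2) :=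
    hf.comp (T := fun p : ℝ × (Fin n → ℝ) => (a + p.1, p.2)) hTa.measurable (C := 1 + |a|)
      (by positivity) fun p => by
      have h1 : ‖p‖ ≤ ‖((a + p.1, p.2) : ℝ × (Fin n → ℝ))‖ + |a| := by
        have : p = (a + p.1, p.2) - (a, 0) := by ext <;> simp
        conv_lhs => rw [this]
        refine (norm_sub_le _ _).trans ?_
        gcongr
        simp [Prod.norm_def]
      nlinarith [norm_nonneg ((a + p.1, p.2) : ℝ × (Fin n → ℝ)), abs_nonneg a]
  rw [← hTa.lintegral_comp hf.measurable.ennreal_ofReal]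
  rcases (integral_nonneg fun p => hfa.nonneg p :
    0 ≤ ∫ p, f (a + p.1, p.2) ∂((volume.restrict (Ioi 0)).prod volume)).eq_or_lt with hz | hpos
  · refine ⟨0, fun g K hg hK _ => ?_⟩
    have e : ∫⁻ p : ℝ × (Fin n → ℝ), ENNReal.ofReal (f (a + p.1, p.2)) = 0 := by
      rw [lintegral_prod_eq_add,
        ← ofReal_integral_eq_lintegral_ofReal hfa.integrable (ae_of_all _ hfa.nonneg),
        ← ofReal_integral_eq_lintegral_ofReal hfa.integrable (ae_of_all _ hfa.nonneg), ← ha, ← hz]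
      simp
    simp [e]
  obtain ⟨c, v, hcv⟩ := exists_shear_of_integral_eq hfa ha hpos
  have hsh := fun (ρ : Measure ℝ) [SFinite ρ] => measurePreserving_shear_snd ρ c v
  have hvol : MeasurePreserving (fun p : ℝ × (Fin n → ℝ) => (p.1, (c + p.1 • v) + p.2)) :=
    hsh volume
  refine ⟨(a, c), fun g K hg hK h => ?_⟩
  rw [← hvol.lintegral_comp hfa.measurable.ennreal_ofReal,
    ← (measurePreserving_shear_fst v).lintegral_comp hg]
  refine H.of_integral_eq (f := fun p => f (a + p.1, (c + p.1 • v) + p.2)) ?_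
    (hg.comp (measurePreserving_shear_fst v).measurable) hK ?_ ?_ ?_ ?_
  · refine hfa.comp (T := fun p : ℝ × (Fin n → ℝ) => (p.1, (c + p.1 • v) + p.2)) hvol.measurable
      (C := 1 + ‖c‖ + ‖v‖) (by positivity) fun p => ?_
    set q : ℝ × (Fin n → ℝ) := (p.1, (c + p.1 • v) + p.2) with hq
    have h1 : ‖p.1‖ ≤ ‖q‖ := norm_fst_le q
    have h2 : ‖p.2‖ ≤ ‖q‖ + ‖c‖ + ‖q‖ * ‖v‖ := by
      have : p.2 = q.2 - c - p.1 • v := by simp only [hq]; abel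
      rw [this]
      refine (norm_sub_le _ _).trans (add_le_add ((norm_sub_le _ _).trans ?_) ?_)
      · gcongr; exact norm_snd_le q
      · rw [norm_smul]; gcongr
    rw [Prod.norm_def, max_le_iff]
    have := norm_nonneg q
    have := norm_nonneg c
    have := norm_nonneg v
    constructor <;> nlinarith [mul_nonneg (norm_nonneg q) (norm_nonneg c)]
  · exact ((hsh _).integral_comp_measurable hfa.measurable).trans
      (ha.trans ((hsh _).integral_comp_measurable hfa.measurable).symm)
  · intro i
    refine Eq.trans ?_ (((hsh _).integral_comp_measurable
      (F := fun p : ℝ × (Fin n → ℝ) => (p.2 i - (c i + p.1 * v i)) * f (a + p.1, p.2))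
      (Measurable.mul (by fun_prop) hfa.measurable)).trans (hcv i).1)
    congr with p
    simp only [Pi.add_apply, Pi.smul_apply, smul_eq_mul]
    ring
  · intro i
    refine Eq.trans ?_ (((hsh _).integral_comp_measurable
      (F := fun p : ℝ × (Fin n → ℝ) => (p.2 i - (c i + p.1 * v i)) * f (a + p.1, p.2))
      (Measurable.mul (by fun_prop) hfa.measurable)).trans (hcv i).2)
    congr with p
    simp only [Pi.add_apply, Pi.smul_apply, smul_eq_mul]
    ring
  · intro x y
    have hxy := h (x.1, x.1 • v + x.2) (-(v ⬝ᵥ y.2) + y.1, y.2)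
    simp only [Prod.mk_add_mk, ← add_assoc] at hxy
    refine hxy.trans_eq ?_
    congr 3
    simp only [add_dotProduct, smul_dotProduct, smul_eq_mul]
    ring

theorem lintegral_eq_iSup_lintegral_truncate {X : Type*} [NormedAddCommGroup X] [MeasurableSpace X]
    [BorelSpace X] {μ : Measure X} {g : X → ℝ≥0∞} (hg : Measurable g) :
    ∫⁻ x, g x ∂μ = ⨆ k : ℕ, ∫⁻ x, ENNReal.ofReal
      ((Metric.closedBall 0 (k : ℝ)).indicator (fun x => (min (g x) k).toReal) x) ∂μ := by
  have h1 : ∀ (k : ℕ) x, ENNReal.ofReal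
      ((Metric.closedBall 0 (k : ℝ)).indicator (fun x => (min (g x) k).toReal) x) =
        (Metric.closedBall 0 (k : ℝ)).indicator (fun x => min (g x) k) x := fun k x => by
    by_cases hx : x ∈ Metric.closedBall 0 (k : ℝ)
    · simp only [indicator_of_mem hx]
      exact ENNReal.ofReal_toReal (by simp)
    · simp [indicator_of_notMem hx]
  simp_rw [h1]
  have hmono : Monotone fun (k : ℕ) x =>
      (Metric.closedBall (0 : X) (k : ℝ)).indicator (fun x => min (g x) k) x := by
    intro k l hkl x
    refine (indicator_le_indicator_of_subset (Metric.closedBall_subset_closedBall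
      (Nat.cast_le.2 hkl)) (fun _ => zero_le) x).trans ?_
    refine indicator_le_indicator (min_le_min le_rfl (by exact_mod_cast hkl))
  rw [← lintegral_iSup (fun k => (hg.min measurable_const).indicator
    Metric.isClosed_closedBall.measurableSet) hmono]
  congr with x
  refine le_antisymm ?_ (iSup_le fun k => ?_)
  · have : g x = ⨆ k : ℕ, min (g x) (k : ℝ≥0∞) := by
      have : ⨆ k : ℕ, min (g x) (k : ℝ≥0∞) = min (g x) (⨆ k : ℕ, (k : ℝ≥0∞)) :=
        (inf_iSup_eq _ _).symm
      rw [this, ENNReal.iSup_natCast, min_top_right]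
    rw [this]
    refine iSup_le fun k => ?_
    obtain ⟨l, hl⟩ := exists_nat_ge ‖x‖
    refine le_trans ?_ (le_iSup _ (max k l))
    rw [indicator_of_mem]
    · gcongr; exact le_max_left _ _
    · have : (l : ℝ) ≤ (max k l : ℕ) := by exact_mod_cast le_max_right k l
      simpa using hl.trans this
  · exact indicator_apply_le fun _ => min_le_left _ _

theorem isTame_truncate {X : Type*} [NormedAddCommGroup X] [MeasurableSpace X]
    [BorelSpace X] {g : X → ℝ≥0∞} (hg : Measurable g) (k : ℕ) :
    IsTame ((Metric.closedBall 0 (k : ℝ)).indicator fun x => (min (g x) k).toReal) := by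
  refine ⟨(hg.min measurable_const).ennreal_toReal.indicator
    Metric.isClosed_closedBall.measurableSet,
    fun x => indicator_nonneg (fun _ _ => ENNReal.toReal_nonneg) x, k, fun x => ⟨?_, fun hx => ?_⟩⟩
  · refine indicator_apply_le' (fun _ => ?_) fun _ => by positivity
    simpa using ENNReal.toReal_mono (ENNReal.natCast_ne_top k) (min_le_right (g x) k)
  · simpa using mem_of_indicator_ne_zero hx

theorem CenteredSantalo.prod {n : ℕ} (H : CenteredSantalo n)
    {f : ℝ × (Fin n → ℝ) → ℝ} (hf : IsTame f)
    {g : ℝ × (Fin n → ℝ) → ℝ≥0∞} {K : ℝ} (hg : Measurable g) (hK : 0 ≤ K)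
    (hbar₁ : ∫ p : ℝ × (Fin n → ℝ), p.1 * f p = 0)
    (hbar₂ : ∀ i, ∫ p : ℝ × (Fin n → ℝ), p.2 i * f p = 0)
    (h : ∀ x y : ℝ × (Fin n → ℝ),
      ENNReal.ofReal (f x) * g y ≤ ENNReal.ofReal (K * Real.exp (-(x.1 * y.1 + x.2 ⬝ᵥ y.2)))) :
    (∫⁻ p, ENNReal.ofReal (f p)) * ∫⁻ p, g p ≤ ENNReal.ofReal ((2 * Real.pi) ^ (n + 1) * K) := by
  rw [lintegral_eq_iSup_lintegral_truncate hg, ENNReal.mul_iSup]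
  refine iSup_le fun k => ?_
  have hk := isTame_truncate hg k
  set φ := (Metric.closedBall 0 (k : ℝ)).indicator fun x => (min (g x) k).toReal with hφ
  have hφg : ∀ x, ENNReal.ofReal (φ x) ≤ g x := fun x => by
    by_cases hx : x ∈ Metric.closedBall 0 (k : ℝ)
    · rw [hφ, indicator_of_mem hx, ENNReal.ofReal_toReal (by simp)]
      exact min_le_left _ _
    · simp [hφ, indicator_of_notMem hx]
  obtain ⟨z, hz⟩ := H.exists_center hk
  let e : ℝ × (Fin n → ℝ) → ℝ := fun x => z.1 * x.1 + z.2 ⬝ᵥ x.2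
  have he : Continuous e := by unfold e dotProduct; fun_prop
  have key := hz (fun x => ENNReal.ofReal (Real.exp (e x) * f x)) K
    (Measurable.ennreal_ofReal (he.rexp.measurable.mul hf.measurable)) hK fun x y => by
      calc _ ≤ g (z + x) * ENNReal.ofReal (Real.exp (e y) * f y) := by gcongr; exact hφg _
        _ = ENNReal.ofReal (Real.exp (e y)) * (ENNReal.ofReal (f y) * g (z + x)) := by
          rw [ENNReal.ofReal_mul (by positivity)]; ring
        _ ≤ ENNReal.ofReal (Real.exp (e y)) * ENNReal.ofReal
            (K * Real.exp (-(y.1 * (z + x).1 + y.2 ⬝ᵥ (z + x).2))) := by gcongr; exact h _ _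
        _ = _ := by
          rw [← ENNReal.ofReal_mul (by positivity), mul_left_comm, ← Real.exp_add]
          congr 3
          simp only [e, Prod.fst_add, Prod.snd_add, dotProduct_comm y.2, add_dotProduct]
          ring
  refine le_trans ?_ key
  rw [mul_comm]
  gcongr 1
  rw [← ofReal_integral_eq_lintegral_ofReal hf.integrable (ae_of_all _ hf.nonneg),
    ← ofReal_integral_eq_lintegral_ofReal (hf.integrable_mul (by fun_prop))
      (ae_of_all _ fun x => mul_nonneg (Real.exp_pos _).le (hf.nonneg x))]
  refine ENNReal.ofReal_le_ofReal ?_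
  have hzero : ∫ x, e x * f x = 0 := by
    have e1 : ∀ x, e x * f x = z.1 * (x.1 * f x) + ∑ i, z.2 i * (x.2 i * f x) := fun x => by
      simp only [e, dotProduct, add_mul, Finset.sum_mul, mul_assoc]
    simp_rw [e1]
    rw [integral_add, integral_finsetSum, integral_const_mul, hbar₁]
    · simp [integral_const_mul, hbar₂]
    · exact fun i _ => (hf.integrable_mul (by fun_prop)).const_mul _
    · exact (hf.integrable_mul (by fun_prop)).const_mul _
    · exact integrable_finsetSum _ fun i _ => (hf.integrable_mul (by fun_prop)).const_mul _
  calc ∫ x, f x = ∫ x, e x * f x + f x := by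
        rw [integral_add (hf.integrable_mul he) hf.integrable, hzero, zero_add]
    _ ≤ ∫ x, Real.exp (e x) * f x := by
        refine integral_mono ((hf.integrable_mul he).add hf.integrable)
          (hf.integrable_mul (by fun_prop)) fun x => ?_
        have := mul_le_mul_of_nonneg_right (Real.add_one_le_exp (e x)) (hf.nonneg x)
        simp only
        linarith

theorem centeredSantalo_zero : CenteredSantalo 0 := by
  intro f g K hf hg hK _ h
  have hv : (volume : Measure (Fin 0 → ℝ)) = Measure.dirac 0 := by
    rw [volume_pi, Measure.pi_of_empty _ 0]
  rw [hv, lintegral_dirac, lintegral_dirac]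
  simpa using h 0 0

theorem CenteredSantalo.succ {n : ℕ} (H : CenteredSantalo n) : CenteredSantalo (n + 1) := by
  intro f g K hf hg hK hbar h
  let T : ℝ × (Fin n → ℝ) → (Fin (n + 1) → ℝ) := fun p => Fin.cons p.1 p.2
  have hT : MeasurePreserving T := by
    have := (volume_preserving_piFinSuccAbove (fun _ : Fin (n + 1) => ℝ) 0).symm
    convert this using 1
    ext p i
    simp [T, MeasurableEquiv.piFinSuccAbove, Fin.insertNthEquiv]
  have hnorm : ∀ p, ‖p‖ ≤ 1 * (‖T p‖ + 1) := fun p => by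
    have h1 : ‖p.1‖ ≤ ‖T p‖ := by simpa [T] using norm_le_pi_norm (T p) 0
    have h2 : ‖p.2‖ ≤ ‖T p‖ := by
      rw [pi_norm_le_iff_of_nonneg (norm_nonneg _)]
      intro i
      simpa [T] using norm_le_pi_norm (T p) i.succ
    rw [one_mul, Prod.norm_def]
    exact (max_le h1 h2).trans (by linarith)
  have hfT : IsTame fun p => f (T p) := hf.comp hT.measurable zero_le_one hnorm
  have hbar' : ∀ i, ∫ p, T p i * f (T p) = 0 := fun i =>
    (hT.integral_comp_measurable (F := fun x => x i * f x)
      (Measurable.mul (by fun_prop) hf.measurable)).trans (hbar i)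
  rw [← hT.lintegral_comp hf.measurable.ennreal_ofReal, ← hT.lintegral_comp hg]
  refine H.prod hfT (hg.comp hT.measurable) hK (by simpa [T] using hbar' 0)
    (fun i => by simpa [T] using hbar' i.succ) fun x y => ?_
  refine (h (T x) (T y)).trans_eq ?_
  simp [T, dotProduct, Fin.sum_univ_succ]

theorem centeredSantalo (n : ℕ) : CenteredSantalo n := by
  induction n with
  | zero => exact centeredSantalo_zero
  | succ n ih => exact ih.succ

theorem EuclideanSpace.lintegral_mul_lintegral_le_of_even {N : ℕ}
    {φ ψ : EuclideanSpace ℝ (Fin N) → ℝ≥0∞} (hφ : Measurable φ) (hψ : Measurable ψ)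
    (hφ_even : ∀ x, φ (-x) = φ x)
    (h : ∀ x y, φ x * ψ y ≤ ENNReal.ofReal (Real.exp (-⟪x, y⟫))) :
    (∫⁻ x, φ x) * ∫⁻ y, ψ y ≤ ENNReal.ofReal ((2 * Real.pi) ^ N) := by
  have hT := PiLp.volume_preserving_toLp (Fin N)
  rw [← hT.lintegral_comp hφ, ← hT.lintegral_comp hψ,
    lintegral_eq_iSup_lintegral_truncate (g := fun x => φ (WithLp.toLp 2 x))
      (hφ.comp hT.measurable), ENNReal.iSup_mul]
  refine iSup_le fun k => ?_
  have hk := isTame_truncate (hφ.comp hT.measurable) k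
  let f : (Fin N → ℝ) → ℝ := (Metric.closedBall (0 : Fin N → ℝ) (k : ℝ)).indicator fun x =>
    (min (φ (WithLp.toLp 2 x)) k).toReal
  have hf : f = (Metric.closedBall (0 : Fin N → ℝ) (k : ℝ)).indicator fun x =>
    (min (φ (WithLp.toLp 2 x)) k).toReal := rfl
  have hf_even : ∀ x, f (-x) = f x := fun x => by
    simp [hf, Set.indicator, WithLp.toLp_neg, hφ_even]
  have hf_le : ∀ x, ENNReal.ofReal (f x) ≤ φ (WithLp.toLp 2 x) := fun x => by
    by_cases hx : x ∈ Metric.closedBall 0 (k : ℝ)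
    · rw [hf, indicator_of_mem hx, ENNReal.ofReal_toReal (by simp)]
      exact min_le_left _ _
    · simp [hf, indicator_of_notMem hx]
  refine (centeredSantalo N f _ 1 hk (hψ.comp hT.measurable) zero_le_one (fun i => ?_)
    fun x y => ?_).trans_eq (by rw [mul_one])
  · have h1 := integral_neg_eq_self (fun x : Fin N → ℝ => x i * f x) volume
    simp only [Pi.neg_apply, hf_even, neg_mul, integral_neg] at h1
    linarith
  · rw [one_mul]
    refine (mul_le_mul' (hf_le x) le_rfl).trans ((h _ _).trans_eq ?_)
    rw [EuclideanSpace.inner_toLp_toLp, star_trivial, dotProduct_comm]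

theorem EuclideanSpace.lintegral_eq_lintegral_toSphere {n : ℕ}
    {G : EuclideanSpace ℝ (Fin (n + 1)) → ℝ≥0∞} (hG : Measurable G) :
    ∫⁻ x, G x = ∫⁻ u : Metric.sphere (0 : EuclideanSpace ℝ (Fin (n + 1))) 1,
      ∫⁻ r in Ioi (0 : ℝ), ENNReal.ofReal (r ^ n) * G (r • (u : EuclideanSpace ℝ (Fin (n + 1))))
        ∂volume ∂(volume : Measure (EuclideanSpace ℝ (Fin (n + 1)))).toSphere := by
  set μ := (volume : Measure (EuclideanSpace ℝ (Fin (n + 1))))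
  have hd : Module.finrank ℝ (EuclideanSpace ℝ (Fin (n + 1))) - 1 = n := by simp
  have hmp := μ.measurePreserving_homeomorphUnitSphereProd
  rw [hd] at hmp
  have hF : Measurable fun p : Metric.sphere (0 : EuclideanSpace ℝ (Fin (n + 1))) 1 × Ioi (0 : ℝ) =>
      G ((p.2 : ℝ) • (p.1 : EuclideanSpace ℝ (Fin (n + 1)))) := hG.comp (by fun_prop)
  calc ∫⁻ x, G x ∂μ = ∫⁻ x in {0}ᶜ, G x ∂μ := by rw [restrict_compl_singleton]
    _ = ∫⁻ x : ({0}ᶜ : Set (EuclideanSpace ℝ (Fin (n + 1)))), G x ∂(μ.comap (↑)) :=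
        (lintegral_subtype_comap (measurableSet_singleton _).compl G).symm
    _ = ∫⁻ p, G ((p.2 : ℝ) • (p.1 : EuclideanSpace ℝ (Fin (n + 1))))
          ∂(μ.toSphere.prod (Measure.volumeIoiPow n)) := by
        rw [← hmp.lintegral_comp hF]
        refine lintegral_congr fun x => ?_
        have hx : ‖(x : EuclideanSpace ℝ (Fin (n + 1)))‖ ≠ 0 := norm_ne_zero_iff.2 x.2
        simp [smul_smul, hx]
    _ = _ := by
        rw [lintegral_prod _ hF.aemeasurable]
        refine lintegral_congr fun u => ?_
        have hFu : Measurable fun r : ℝ => G (r • (u : EuclideanSpace ℝ (Fin (n + 1)))) :=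
          hG.comp (by fun_prop)
        rw [Measure.volumeIoiPow, lintegral_withDensity_eq_lintegral_mul _ (by fun_prop)
          (g := fun r : Ioi (0 : ℝ) => G ((r : ℝ) • (u : EuclideanSpace ℝ (Fin (n + 1)))))
          (hFu.comp measurable_subtype_coe)]
        exact lintegral_subtype_comap measurableSet_Ioi
          (fun r => ENNReal.ofReal (r ^ n) * G (r • (u : EuclideanSpace ℝ (Fin (n + 1)))))

/-- The (unnormalized) surface measure of the unit sphere, as a measure on the ambient space. -/
noncomputable def surfaceMeasure (n : ℕ) : Measure (EuclideanSpace ℝ (Fin (n + 1))) :=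
  (volume : Measure (EuclideanSpace ℝ (Fin (n + 1)))).toSphere.map (↑)

/-- The radial integral `∫₀^∞ rⁿ exp (-r² / 2) dr`. -/
noncomputable def radialMoment (n : ℕ) : ℝ :=
  2 ^ (((n : ℝ) + 1) / 2) * (1 / 2) * Real.Gamma (((n : ℝ) + 1) / 2)

theorem radialMoment_pos (n : ℕ) : 0 < radialMoment n := by
  have := Real.Gamma_pos_of_pos (s := ((n : ℝ) + 1) / 2) (by positivity)
  unfold radialMoment
  positivity

theorem lintegral_pow_mul_exp_neg_sq (n : ℕ) (a : ℝ) :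
    ∫⁻ r in Ioi (0 : ℝ), ENNReal.ofReal (r ^ n) *
      ENNReal.ofReal (Real.exp (-(r ^ 2 * Real.exp (-2 * a)) / 2)) =
    ENNReal.ofReal (radialMoment n * Real.exp ((n + 1) * a)) := by
  have hb : 0 < Real.exp (-2 * a) / 2 := by positivity
  have key := integral_rpow_mul_exp_neg_mul_rpow (p := 2) (q := n) two_pos
    (by have : (0 : ℝ) ≤ n := n.cast_nonneg
        linarith) hb
  have hval : (Real.exp (-2 * a) / 2) ^ (-((n : ℝ) + 1) / 2) * (1 / 2) *
      Real.Gamma (((n : ℝ) + 1) / 2) = radialMoment n * Real.exp ((n + 1) * a) := by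
    rw [radialMoment, Real.div_rpow (Real.exp_pos _).le two_pos.le, ← Real.exp_mul, neg_div,
      Real.rpow_neg two_pos.le]
    field_simp
  rw [hval] at key
  have e : ∀ r ∈ Ioi (0 : ℝ), ENNReal.ofReal (r ^ n) *
      ENNReal.ofReal (Real.exp (-(r ^ 2 * Real.exp (-2 * a)) / 2)) =
      ENNReal.ofReal (r ^ (n : ℝ) * Real.exp (-(Real.exp (-2 * a) / 2) * r ^ (2 : ℝ))) := by
    intro r hr
    rw [← ENNReal.ofReal_mul (pow_nonneg (le_of_lt hr) _), Real.rpow_natCast, Real.rpow_two]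
    congr 3
    ring
  rw [setLIntegral_congr_fun measurableSet_Ioi e, ← key, ofReal_integral_eq_lintegral_ofReal]
  · refine Integrable.of_integral_ne_zero ?_
    rw [key]
    have := radialMoment_pos n
    positivity
  · filter_upwards [ae_restrict_mem measurableSet_Ioi] with r hr
    have := le_of_lt (mem_Ioi.1 hr)
    positivity

theorem lintegral_exp_neg_radial {n : ℕ} {f : EuclideanSpace ℝ (Fin (n + 1)) → ℝ}
    {h : EuclideanSpace ℝ (Fin (n + 1)) → ℝ≥0∞} (hf : Measurable f) (hh : Measurable h) :
    ∫⁻ x, ENNReal.ofReal (Real.exp (-(‖x‖ ^ 2 * Real.exp (-2 * f (‖x‖⁻¹ • x))) / 2)) *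
      h (‖x‖⁻¹ • x) = ENNReal.ofReal (radialMoment n) *
        ∫⁻ u, ENNReal.ofReal (Real.exp ((n + 1) * f u)) * h u ∂surfaceMeasure n := by
  have hd : Measurable fun x : EuclideanSpace ℝ (Fin (n + 1)) => ‖x‖⁻¹ • x := by fun_prop
  have hfd : Measurable fun x : EuclideanSpace ℝ (Fin (n + 1)) => f (‖x‖⁻¹ • x) := hf.comp hd
  have hhd : Measurable fun x : EuclideanSpace ℝ (Fin (n + 1)) => h (‖x‖⁻¹ • x) := hh.comp hd
  rw [EuclideanSpace.lintegral_eq_lintegral_toSphere (by fun_prop),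
    surfaceMeasure, lintegral_map (by fun_prop) measurable_subtype_coe,
    ← lintegral_const_mul _ (by fun_prop)]
  refine lintegral_congr fun u => ?_
  have hu : ‖(u : EuclideanSpace ℝ (Fin (n + 1)))‖ = 1 := by simp
  have e : ∀ r ∈ Ioi (0 : ℝ), ENNReal.ofReal (r ^ n) *
      (ENNReal.ofReal (Real.exp (-(‖r • (u : EuclideanSpace ℝ (Fin (n + 1)))‖ ^ 2 *
        Real.exp (-2 * f (‖r • (u : EuclideanSpace ℝ (Fin (n + 1)))‖⁻¹ • r •
          (u : EuclideanSpace ℝ (Fin (n + 1)))))) / 2)) *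
      h (‖r • (u : EuclideanSpace ℝ (Fin (n + 1)))‖⁻¹ • r •
          (u : EuclideanSpace ℝ (Fin (n + 1))))) =
      (ENNReal.ofReal (r ^ n) * ENNReal.ofReal (Real.exp (-(r ^ 2 * Real.exp (-2 * f u)) / 2))) *
        h u := by
    intro r hr
    have hr' : ‖r • (u : EuclideanSpace ℝ (Fin (n + 1)))‖ = r := by
      rw [norm_smul, hu, mul_one, Real.norm_of_nonneg (le_of_lt hr)]
    rw [hr', inv_smul_smul₀ (ne_of_gt hr), mul_assoc]
  rw [setLIntegral_congr_fun measurableSet_Ioi e, lintegral_mul_const _ (by fun_prop),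
    lintegral_pow_mul_exp_neg_sq, ENNReal.ofReal_mul (radialMoment_pos n).le, mul_assoc]

theorem surfaceMeasure_univ (n : ℕ) : ENNReal.ofReal (radialMoment n) * surfaceMeasure n univ =
    ENNReal.ofReal ((2 * Real.pi) ^ (((n : ℝ) + 1) / 2)) := by
  have h1 := lintegral_exp_neg_radial (n := n) (f := 0) (h := 1) measurable_zero measurable_one
  have h2 := GaussianFourier.integral_rexp_neg_mul_sq_norm
    (V := EuclideanSpace ℝ (Fin (n + 1))) (b := 1 / 2) (by norm_num)
  simp only [Pi.zero_apply, mul_zero, Real.exp_zero, mul_one, Pi.one_apply, ENNReal.ofReal_one,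
    lintegral_one] at h1
  rw [← h1]
  have e : (2 * Real.pi) ^ (((n : ℝ) + 1) / 2) =
      ∫ x : EuclideanSpace ℝ (Fin (n + 1)), Real.exp (-‖x‖ ^ 2 / 2) := by
    convert h2.symm using 2
    · ring
    · simp
    · ring_nf
  rw [e, ofReal_integral_eq_lintegral_ofReal _ (ae_of_all _ fun x => (Real.exp_pos _).le)]
  refine Integrable.of_integral_ne_zero ?_
  rw [← e]
  positivity

theorem surfaceMeasure_map_linearIsometryEquiv {n : ℕ}
    (T : EuclideanSpace ℝ (Fin (n + 1)) ≃ₗᵢ[ℝ] EuclideanSpace ℝ (Fin (n + 1))) :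
    (surfaceMeasure n).map T = surfaceMeasure n := by
  ext A hA
  have hc : ENNReal.ofReal (radialMoment n) ≠ 0 := by simpa using radialMoment_pos n
  have key : ∀ B, MeasurableSet B → ENNReal.ofReal (radialMoment n) * surfaceMeasure n B =
      ∫⁻ x, ENNReal.ofReal (Real.exp (-‖x‖ ^ 2 / 2)) * B.indicator 1 (‖x‖⁻¹ • x) := by
    intro B hB
    have h1 := lintegral_exp_neg_radial (n := n) (f := 0) (h := B.indicator 1) measurable_zero
      (measurable_one.indicator hB)
    simp only [Pi.zero_apply, mul_zero, Real.exp_zero, mul_one, ENNReal.ofReal_one, one_mul,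
      lintegral_indicator_one hB] at h1
    exact h1.symm
  rw [Measure.map_apply T.continuous.measurable hA, ← ENNReal.mul_right_inj hc
    ENNReal.ofReal_ne_top, key _ hA, key _ (T.continuous.measurable hA)]
  have hi : Measurable fun x : EuclideanSpace ℝ (Fin (n + 1)) =>
      A.indicator (1 : EuclideanSpace ℝ (Fin (n + 1)) → ℝ≥0∞) (‖x‖⁻¹ • x) := (measurable_one.indicator hA).comp (by fun_prop)
  rw [← T.measurePreserving.lintegral_comp (f := fun x => ENNReal.ofReal
    (Real.exp (-‖x‖ ^ 2 / 2)) * A.indicator 1 (‖x‖⁻¹ • x))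
    (by fun_prop)]
  refine lintegral_congr fun x => ?_
  simp only [LinearIsometryEquiv.norm_map, ← map_smul]
  rfl

section Uniqueness

variable {F : Type*} [NormedAddCommGroup F] [InnerProductSpace ℝ F] [MeasurableSpace F]
  [BorelSpace F]

theorem charFun_eq_of_norm_eq {σ : Measure F} (hσ : ∀ T : F ≃ₗᵢ[ℝ] F, σ.map T = σ) {s t : F}
    (h : ‖s‖ = ‖t‖) : charFun σ s = charFun σ t := by
  obtain ⟨T, hT⟩ : ∃ T : F ≃ₗᵢ[ℝ] F, T s = t :=
    ⟨(ℝ ∙ (s - t))ᗮ.reflection, Submodule.reflection_sub h⟩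
  have hm : MeasurePreserving T σ σ := ⟨T.continuous.measurable, hσ T⟩
  rw [charFun_apply, charFun_apply, ← hT]
  refine Eq.trans ?_ (hm.integral_comp T.toHomeomorph.measurableEmbedding _)
  simp only [LinearIsometryEquiv.inner_map_map]

theorem eq_of_map_linearIsometryEquiv_eq [SecondCountableTopology F] [CompleteSpace F]
    {σ τ : Measure F} [IsProbabilityMeasure σ] [IsProbabilityMeasure τ]
    (hσ : ∀ T : F ≃ₗᵢ[ℝ] F, σ.map T = σ) (hτ : ∀ T : F ≃ₗᵢ[ℝ] F, τ.map T = τ)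
    (hσ₁ : ∀ᵐ x ∂σ, ‖x‖ = 1) (hτ₁ : ∀ᵐ x ∂τ, ‖x‖ = 1) : σ = τ := by
  refine Measure.ext_of_charFun (funext fun t => ?_)
  have hint : ∀ t : F, Integrable (Function.uncurry fun v u : F =>
      Complex.exp (⟪u, ‖t‖ • v⟫ * Complex.I)) (τ.prod σ) := fun t => by
    refine Integrable.of_bound (Continuous.aestronglyMeasurable ?_) 1 (ae_of_all _ fun p => ?_)
    · unfold Function.uncurry
      fun_prop
    · simp [Function.uncurry, Complex.norm_exp_ofReal_mul_I]
  calc charFun σ t = ∫ _, charFun σ t ∂τ := by simp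
    _ = ∫ v, ∫ u, Complex.exp (⟪u, ‖t‖ • v⟫ * Complex.I) ∂σ ∂τ := by
        refine integral_congr_ae ?_
        filter_upwards [hτ₁] with v hv
        exact charFun_eq_of_norm_eq hσ (by simp [norm_smul, hv])
    _ = ∫ u, ∫ v, Complex.exp (⟪u, ‖t‖ • v⟫ * Complex.I) ∂τ ∂σ := integral_integral_swap (hint t)
    _ = ∫ _, charFun τ t ∂σ := by
        refine integral_congr_ae ?_
        filter_upwards [hσ₁] with u hu
        rw [← charFun_eq_of_norm_eq hτ (s := ‖t‖ • u) (by simp [norm_smul, hu]), charFun_apply]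
        simp only [inner_smul_right, real_inner_comm]
    _ = charFun τ t := by simp

end Uniqueness

theorem ae_norm_eq_one_surfaceMeasure (n : ℕ) : ∀ᵐ x ∂surfaceMeasure n, ‖x‖ = 1 := by
  rw [surfaceMeasure, ae_map_iff measurable_subtype_coe.aemeasurable
    (measurableSet_eq_fun measurable_norm measurable_const)]
  exact ae_of_all _ fun u => by simp

theorem eq_smul_surfaceMeasure {n : ℕ}
    {σ : Measure (EuclideanSpace ℝ (Fin (n + 1)))} [IsProbabilityMeasure σ]
    (hσ₁ : ∀ᵐ x ∂σ, ‖x‖ = 1)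
    (hσ : ∀ T : EuclideanSpace ℝ (Fin (n + 1)) ≃ₗᵢ[ℝ] EuclideanSpace ℝ (Fin (n + 1)),
      σ.map T = σ) :
    σ = (surfaceMeasure n univ)⁻¹ • surfaceMeasure n := by
  have hfin : IsFiniteMeasure (surfaceMeasure n) := by
    unfold surfaceMeasure; infer_instance
  have hne : NeZero (surfaceMeasure n) := by
    refine ⟨fun h => ?_⟩
    have := surfaceMeasure_univ n
    rw [h] at this
    simp only [Measure.coe_zero, Pi.zero_apply, mul_zero] at this
    exact (ENNReal.ofReal_pos.2 (by positivity)).ne this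
  refine eq_of_map_linearIsometryEquiv_eq hσ (fun T => ?_) hσ₁
    (Measure.ae_smul_measure (ae_norm_eq_one_surfaceMeasure n) _)
  rw [Measure.map_smul, surfaceMeasure_map_linearIsometryEquiv]

theorem exp_neg_mul_exp_neg_le {E : Type*} [NormedAddCommGroup E] [InnerProductSpace ℝ E]
    {f g : E → ℝ} (h : ∀ u v : E, ‖u‖ = 1 → ‖v‖ = 1 → 0 < ⟪u, v⟫ →
      f u + g v ≤ Real.log (1 / ⟪u, v⟫)) (x y : E) :
    Real.exp (-(‖x‖ ^ 2 * Real.exp (-2 * f (‖x‖⁻¹ • x))) / 2) *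
      Real.exp (-(‖y‖ ^ 2 * Real.exp (-2 * g (‖y‖⁻¹ • y))) / 2) ≤ Real.exp (-⟪x, y⟫) := by
  rw [← Real.exp_add, Real.exp_le_exp]
  set u := ‖x‖⁻¹ • x with hu
  set v := ‖y‖⁻¹ • y with hv
  have e : ∀ a : ℝ, Real.exp (-2 * a) = Real.exp (-a) ^ 2 := fun a => by
    rw [← Real.exp_nat_mul]; ring_nf
  rw [e, e]
  rcases le_or_gt ⟪x, y⟫ 0 with hxy | hxy
  · have := mul_nonneg (sq_nonneg ‖x‖) (sq_nonneg (Real.exp (-f u)))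
    have := mul_nonneg (sq_nonneg ‖y‖) (sq_nonneg (Real.exp (-g v)))
    linarith
  · have hx : 0 < ‖x‖ := norm_pos_iff.2 fun h0 => by simp [h0] at hxy
    have hy : 0 < ‖y‖ := norm_pos_iff.2 fun h0 => by simp [h0] at hxy
    have huv : ⟪x, y⟫ = ‖x‖ * ‖y‖ * ⟪u, v⟫ := by
      rw [hu, hv, real_inner_smul_left, real_inner_smul_right]
      field_simp
    have hpos : 0 < ⟪u, v⟫ := by
      rw [huv] at hxy
      exact (mul_pos_iff_of_pos_left (mul_pos hx hy)).1 hxy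
    have h1 := h u v (by simp [hu, norm_smul, hx.ne']) (by simp [hv, norm_smul, hy.ne']) hpos
    have h2 : ⟪u, v⟫ ≤ Real.exp (-f u) * Real.exp (-g v) := by
      rw [← Real.exp_add, ← Real.exp_log hpos, Real.exp_le_exp]
      rw [one_div, Real.log_inv] at h1
      linarith
    have h3 := mul_le_mul_of_nonneg_left h2 (mul_pos hx hy).le
    rw [← huv] at h3
    nlinarith [sq_nonneg (‖x‖ * Real.exp (-f u) - ‖y‖ * Real.exp (-g v))]

theorem lintegral_exp_mul_lintegral_exp_le_one {n : ℕ}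
    {σ : Measure (EuclideanSpace ℝ (Fin (n + 1)))} [IsProbabilityMeasure σ]
    (hσ₁ : ∀ᵐ x ∂σ, ‖x‖ = 1)
    (hσ : ∀ T : EuclideanSpace ℝ (Fin (n + 1)) ≃ₗᵢ[ℝ] EuclideanSpace ℝ (Fin (n + 1)),
      σ.map T = σ)
    {f g : EuclideanSpace ℝ (Fin (n + 1)) → ℝ} (hf : Measurable f) (hg : Measurable g)
    (hf_even : ∀ u, f (-u) = f u)
    (h : ∀ u v : EuclideanSpace ℝ (Fin (n + 1)), ‖u‖ = 1 → ‖v‖ = 1 → 0 < ⟪u, v⟫ →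
      f u + g v ≤ Real.log (1 / ⟪u, v⟫)) :
    (∫⁻ u, ENNReal.ofReal (Real.exp ((n + 1) * f u)) ∂σ) *
      ∫⁻ v, ENNReal.ofReal (Real.exp ((n + 1) * g v)) ∂σ ≤ 1 := by
  have hfm : Measurable fun x : EuclideanSpace ℝ (Fin (n + 1)) => f (‖x‖⁻¹ • x) :=
    hf.comp (by fun_prop)
  have hgm : Measurable fun x : EuclideanSpace ℝ (Fin (n + 1)) => g (‖x‖⁻¹ • x) :=
    hg.comp (by fun_prop)
  have key := EuclideanSpace.lintegral_mul_lintegral_le_of_even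
    (φ := fun x : EuclideanSpace ℝ (Fin (n + 1)) =>
      ENNReal.ofReal (Real.exp (-(‖x‖ ^ 2 * Real.exp (-2 * f (‖x‖⁻¹ • x))) / 2)))
    (ψ := fun x : EuclideanSpace ℝ (Fin (n + 1)) =>
      ENNReal.ofReal (Real.exp (-(‖x‖ ^ 2 * Real.exp (-2 * g (‖x‖⁻¹ • x))) / 2)))
    (by fun_prop) (by fun_prop) (fun x => by simp [hf_even]) fun x y => by
      rw [← ENNReal.ofReal_mul (Real.exp_pos _).le]
      exact ENNReal.ofReal_le_ofReal (exp_neg_mul_exp_neg_le h x y)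
  have h1 := lintegral_exp_neg_radial (h := 1) hf measurable_one
  have h2 := lintegral_exp_neg_radial (h := 1) hg measurable_one
  simp only [Pi.one_apply, mul_one] at h1 h2
  rw [h1, h2] at key
  have hu := surfaceMeasure_univ n
  set R := ENNReal.ofReal (radialMoment n) with hR
  set c := surfaceMeasure n univ with hc
  have hR0 : R ≠ 0 := by simpa [hR] using radialMoment_pos n
  have hRc : R * c ≠ 0 := by
    rw [hu]; exact (ENNReal.ofReal_pos.2 (by positivity)).ne'
  have hRt : R * c ≠ ⊤ := by rw [hu]; exact ENNReal.ofReal_ne_top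
  have hsq : ENNReal.ofReal ((2 * Real.pi) ^ (n + 1)) = (R * c) * (R * c) := by
    rw [hu, ← ENNReal.ofReal_mul (by positivity), ← Real.rpow_add (by positivity), add_halves]
    norm_cast
  rw [hsq] at key
  rw [eq_smul_surfaceMeasure hσ₁ hσ]
  simp only [lintegral_smul_measure, smul_eq_mul, ← hc]
  set A := ∫⁻ u, ENNReal.ofReal (Real.exp ((n + 1) * f u)) ∂surfaceMeasure n
  set B := ∫⁻ u, ENNReal.ofReal (Real.exp ((n + 1) * g u)) ∂surfaceMeasure n
  have e : ∀ X, c⁻¹ * X = (R * c)⁻¹ * (R * X) := fun X => by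
    rw [ENNReal.mul_inv (Or.inl hR0) (Or.inl ENNReal.ofReal_ne_top), mul_mul_mul_comm,
      ENNReal.inv_mul_cancel hR0 ENNReal.ofReal_ne_top, one_mul]
  rw [e A, e B, mul_mul_mul_comm]
  refine (mul_le_mul_right key _).trans_eq ?_
  rw [mul_mul_mul_comm, ENNReal.inv_mul_cancel hRc hRt, one_mul]

theorem integral_le_integral_llr_add_log {α : Type*} [MeasurableSpace α] {ν σ : Measure α}
    [IsProbabilityMeasure ν] [IsProbabilityMeasure σ] (hac : ν ≪ σ)
    (hint : Integrable (llr ν σ) ν) {F : α → ℝ} (hF : Integrable F ν)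
    (hFσ : Integrable (fun x => Real.exp (F x)) σ) :
    ∫ x, F x ∂ν ≤ ∫ x, llr ν σ x ∂ν + Real.log (∫ x, Real.exp (F x) ∂σ) := by
  have := isProbabilityMeasure_tilted hFσ
  have h1 := integral_llr_tilted_right hac hF hFσ hint
  have h2 := InformationTheory.integral_llr_add_sub_measure_univ_nonneg
    (hac.trans (absolutelyContinuous_tilted hFσ)) (integrable_llr_tilted_right hac hF hint hFσ)
  rw [h1] at h2
  simp only [probReal_univ] at h2
  linarith

theorem integral_add_comp_neg_div_two {E : Type*} [NormedAddCommGroup E] [MeasurableSpace E]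
    [BorelSpace E] {ν : Measure E} (hν : ν.map (fun u => -u) = ν) {f : E → ℝ}
    (hf : Integrable f ν) :
    Integrable (fun u => (f u + f (-u)) / 2) ν ∧ ∫ u, (f u + f (-u)) / 2 ∂ν = ∫ u, f u ∂ν := by
  have hm : MeasurePreserving (fun u : E => -u) ν ν := ⟨measurable_neg, hν⟩
  have hi : Integrable (fun u => f (-u)) ν := hm.integrable_comp_of_integrable hf
  refine ⟨(hf.add hi).div_const 2, ?_⟩
  have h1 : ∫ u, f (-u) ∂ν = ∫ u, f u ∂ν :=
    hm.integral_comp (Homeomorph.neg E).measurableEmbedding f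
  rw [integral_div, integral_add hf hi, h1, add_self_div_two]

theorem integral_add_integral_le_integral_llr {n : ℕ}
    {σ ν₁ ν₂ : Measure (EuclideanSpace ℝ (Fin (n + 1)))} [IsProbabilityMeasure σ]
    [IsProbabilityMeasure ν₁] [IsProbabilityMeasure ν₂]
    (hσ₁ : ∀ᵐ x ∂σ, ‖x‖ = 1)
    (hσ : ∀ T : EuclideanSpace ℝ (Fin (n + 1)) ≃ₗᵢ[ℝ] EuclideanSpace ℝ (Fin (n + 1)),
      σ.map T = σ)
    (hν₁ : ν₁.map (fun u => -u) = ν₁) (hν₂ : ν₂.map (fun u => -u) = ν₂)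
    (hac₁ : ν₁ ≪ σ) (hint₁ : Integrable (llr ν₁ σ) ν₁)
    (hac₂ : ν₂ ≪ σ) (hint₂ : Integrable (llr ν₂ σ) ν₂)
    (f g : BoundedContinuousFunction (EuclideanSpace ℝ (Fin (n + 1))) ℝ)
    (h : ∀ u v : EuclideanSpace ℝ (Fin (n + 1)), ‖u‖ = 1 → ‖v‖ = 1 → 0 < ⟪u, v⟫ →
      f u + g v ≤ Real.log (1 / ⟪u, v⟫)) :
    (n + 1) * (∫ u, f u ∂ν₁ + ∫ v, g v ∂ν₂) ≤
      ∫ x, llr ν₁ σ x ∂ν₁ + ∫ x, llr ν₂ σ x ∂ν₂ := by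
  have hexp : ∀ f : BoundedContinuousFunction (EuclideanSpace ℝ (Fin (n + 1))) ℝ,
      Integrable (fun u => Real.exp ((n + 1) * ((f u + f (-u)) / 2))) σ := fun f => by
    refine Integrable.of_bound (Continuous.aestronglyMeasurable (by fun_prop))
      (Real.exp ((n + 1) * ‖f‖)) (ae_of_all _ fun u => ?_)
    rw [Real.norm_of_nonneg (Real.exp_pos _).le, Real.exp_le_exp]
    have h1 := (le_abs_self _).trans (f.norm_coe_le_norm u)
    have h2 := (le_abs_self _).trans (f.norm_coe_le_norm (-u))
    gcongr
    linarith
  obtain ⟨if₁, ef⟩ := integral_add_comp_neg_div_two hν₁ (f.integrable ν₁)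
  obtain ⟨ig₂, eg⟩ := integral_add_comp_neg_div_two hν₂ (g.integrable ν₂)
  have h₁ := integral_le_integral_llr_add_log hac₁ hint₁ (if₁.const_mul (n + 1)) (hexp f)
  have h₂ := integral_le_integral_llr_add_log hac₂ hint₂ (ig₂.const_mul (n + 1)) (hexp g)
  rw [integral_const_mul, ef] at h₁
  rw [integral_const_mul, eg] at h₂
  have key := lintegral_exp_mul_lintegral_exp_le_one hσ₁ hσ
    (f := fun u => (f u + f (-u)) / 2) (g := fun u => (g u + g (-u)) / 2)
    (by fun_prop) (by fun_prop) (fun u => by simp [add_comm]) fun u v hu hv huv => by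
      have h3 := h u v hu hv huv
      have h4 := h (-u) (-v) (by simpa) (by simpa) (by simpa)
      simp only [inner_neg_neg] at h4
      linarith
  rw [← ofReal_integral_eq_lintegral_ofReal (hexp f) (ae_of_all _ fun _ => (Real.exp_pos _).le),
    ← ofReal_integral_eq_lintegral_ofReal (hexp g) (ae_of_all _ fun _ => (Real.exp_pos _).le),
    ← ENNReal.ofReal_mul (integral_nonneg fun _ => (Real.exp_pos _).le),
    ENNReal.ofReal_le_one] at key
  have hlog := Real.log_nonpos (mul_nonneg (integral_nonneg fun _ => (Real.exp_pos _).le)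
    (integral_nonneg fun _ => (Real.exp_pos _).le)) key
  rw [Real.log_mul (integral_exp_pos (hexp f)).ne' (integral_exp_pos (hexp g)).ne'] at hlog
  linarith

theorem exists_measure_integral_eq {Y : Type*} [TopologicalSpace Y] [T2Space Y] [CompactSpace Y]
    [MeasurableSpace Y] [BorelSpace Y] (Λ : C(Y, ℝ) →ₗ[ℝ] ℝ)
    (hΛ : ∀ h : C(Y, ℝ), (∀ y, 0 ≤ h y) → 0 ≤ Λ h) :
    ∃ π : Measure Y, IsFiniteMeasure π ∧ ∀ h : C(Y, ℝ), ∫ y, h y ∂π = Λ h := by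
  let e : CompactlySupportedContinuousMap Y ℝ →ₗ[ℝ] C(Y, ℝ) :=
    { toFun := fun h => h.toContinuousMap
      map_add' := fun _ _ => rfl
      map_smul' := fun _ _ => rfl }
  let L : CompactlySupportedContinuousMap Y ℝ →ₚ[ℝ] ℝ :=
    PositiveLinearMap.mk₀ (Λ.comp e) fun h hh => hΛ _ fun y => hh y
  refine ⟨RealRMK.rieszMeasure L, ?_, fun h => ?_⟩
  · have : (RealRMK.rieszMeasure L).Regular := by unfold RealRMK.rieszMeasure; infer_instance
    exact ⟨isCompact_univ.measure_lt_top⟩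
  · exact RealRMK.integral_rieszMeasure L (CompactlySupportedContinuousMap.continuousMapEquiv h)

theorem exists_coupling_integral_le {X : Type*} [TopologicalSpace X] [T2Space X] [CompactSpace X]
    [SecondCountableTopology X] [MeasurableSpace X] [BorelSpace X] [HasOuterApproxClosed X]
    {ν₁ ν₂ : Measure X} [IsProbabilityMeasure ν₁] [IsProbabilityMeasure ν₂]
    (c : X × X → ℝ≥0∞) {M : ℝ}
    (hdual : ∀ f g : C(X, ℝ), (∀ p : X × X, ENNReal.ofReal (f p.1 + g p.2) ≤ c p) →
      ∫ u, f u ∂ν₁ + ∫ v, g v ∂ν₂ ≤ M) :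
    ∃ π : Measure (X × X), π.map Prod.fst = ν₁ ∧ π.map Prod.snd = ν₂ ∧
      ∀ h : C(X × X, ℝ), (∀ p, ENNReal.ofReal (h p) ≤ c p) → ∫ p, h p ∂π ≤ M := by
  have hint : ∀ (h : C(X × X, ℝ)) (μ : Measure (X × X)) [IsFiniteMeasure μ],
      Integrable (fun p => h p) μ :=
    fun h μ _ => (BoundedContinuousFunction.mkOfCompact h).integrable μ
  have hintX : ∀ (h : C(X, ℝ)) (μ : Measure X) [IsFiniteMeasure μ], Integrable (fun p => h p) μ :=
    fun h μ _ => (BoundedContinuousFunction.mkOfCompact h).integrable μ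
  let J : (C(X, ℝ) × C(X, ℝ)) →ₗ[ℝ] C(X × X, ℝ) :=
    { toFun := fun q => q.1.comp ContinuousMap.fst + q.2.comp ContinuousMap.snd
      map_add' := fun q r => by ext p; simp [add_add_add_comm]
      map_smul' := fun a q => by ext p; simp }
  have hJ : ∀ q p, J q p = q.1 p.1 + q.2 p.2 := fun _ _ => rfl
  let s : PointedCone ℝ (C(X × X, ℝ) × ℝ) :=
    { carrier := {q | 0 ≤ q.2 ∧ ∀ p, ENNReal.ofReal (-q.1 p) ≤ ENNReal.ofReal q.2 * c p}
      add_mem' := by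
        rintro q r ⟨hq, hq'⟩ ⟨hr, hr'⟩
        refine ⟨add_nonneg hq hr, fun p => ?_⟩
        simp only [Prod.fst_add, Prod.snd_add, ContinuousMap.add_apply, neg_add]
        rw [ENNReal.ofReal_add hq hr, add_mul]
        exact ENNReal.ofReal_add_le.trans (add_le_add (hq' p) (hr' p))
      zero_mem' := by simp
      smul_mem' := by
        rintro ⟨a, ha⟩ q ⟨hq, hq'⟩
        refine ⟨mul_nonneg ha hq, fun p => ?_⟩
        change ENNReal.ofReal (-(a * q.1 p)) ≤ ENNReal.ofReal (a * q.2) * c p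
        rw [← mul_neg, ENNReal.ofReal_mul ha, ENNReal.ofReal_mul ha, mul_assoc]
        exact mul_le_mul_right (hq' p) _ }
  have hs : ∀ q, q ∈ s ↔ 0 ≤ q.2 ∧ ∀ p, ENNReal.ofReal (-q.1 p) ≤ ENNReal.ofReal q.2 * c p :=
    fun _ => Iff.rfl
  let I : (C(X × X, ℝ) × ℝ) →ₗ[ℝ] ℝ :=
    { toFun := fun q => ∫ p, q.1 p ∂(ν₁.prod ν₂) + q.2 * M
      map_add' := fun q r => by
        simp only [Prod.fst_add, Prod.snd_add, ContinuousMap.add_apply]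
        rw [integral_add (hint _ _) (hint _ _)]; ring
      map_smul' := fun a q => by
        simp only [Prod.smul_fst, Prod.smul_snd, ContinuousMap.smul_apply, smul_eq_mul,
          RingHom.id_apply]
        rw [integral_const_mul]; ring }
  have hI : ∀ f g t, I (J (f, g), t) = ∫ u, f u ∂ν₁ + ∫ v, g v ∂ν₂ + t * M := by
    intro f g t
    change ∫ p, (f p.1 + g p.2) ∂(ν₁.prod ν₂) + t * M = _
    rw [integral_add ((hintX f ν₁).comp_fst ν₂) ((hintX g ν₂).comp_snd ν₁)]
    simp [integral_fun_fst, integral_fun_snd]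
  let D : Submodule ℝ (C(X × X, ℝ) × ℝ) := (LinearMap.range J).prod ⊤
  have hnonneg : ∀ x : D, (x : C(X × X, ℝ) × ℝ) ∈ s → 0 ≤ I.domRestrict D x := by
    rintro ⟨⟨k, t⟩, hk⟩ hq
    obtain ⟨⟨f, g⟩, hfg⟩ := (Submodule.mem_prod.1 hk).1
    simp only at hfg
    subst hfg
    change 0 ≤ I (J (f, g), t)
    obtain ⟨ht, hq⟩ := (hs _).1 hq
    simp only [hJ] at ht hq
    rcases ht.eq_or_lt with rfl | ht
    · simp only [ENNReal.ofReal_zero, zero_mul, nonpos_iff_eq_zero, ENNReal.ofReal_eq_zero] at hq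
      change 0 ≤ ∫ p, J (f, g) p ∂(ν₁.prod ν₂) + 0 * M
      rw [zero_mul, add_zero]
      exact integral_nonneg fun p => (neg_nonpos.1 (hq p) : 0 ≤ f p.1 + g p.2)
    · rw [hI]
      have h1 := hdual (-t⁻¹ • f) (-t⁻¹ • g) fun p => by
        have h2 := mul_le_mul_right (hq p) (ENNReal.ofReal t⁻¹)
        rw [← mul_assoc, ← ENNReal.ofReal_mul (by positivity), ← ENNReal.ofReal_mul (by positivity),
          inv_mul_cancel₀ ht.ne', ENNReal.ofReal_one, one_mul] at h2
        convert h2 using 2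
        simp
        ring
      simp only [ContinuousMap.smul_apply, smul_eq_mul, integral_const_mul] at h1
      have h3 := mul_le_mul_of_nonneg_left h1 ht.le
      field_simp at h3
      linarith
  have hdense : ∀ y, ∃ x : D, (x : C(X × X, ℝ) × ℝ) + y ∈ s := by
    rintro ⟨h, t⟩
    refine ⟨⟨(J (ContinuousMap.const _ ‖h‖, 0), |t|), ⟨⟨_, rfl⟩, trivial⟩⟩, (hs _).2
      ⟨by simpa using neg_le_iff_add_nonneg'.1 (neg_abs_le t), fun p => ?_⟩⟩
    rw [ENNReal.ofReal_of_nonpos]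
    · exact zero_le
    · have := (abs_le.1 (h.norm_coe_le_norm p)).1
      simp [hJ]
      linarith
  obtain ⟨G, hGI, hGs⟩ := riesz_extension s ⟨D, I.domRestrict D⟩ hnonneg hdense
  have hGI' : ∀ f g t, G (J (f, g), t) = ∫ u, f u ∂ν₁ + ∫ v, g v ∂ν₂ + t * M := fun f g t =>
    (hGI ⟨(J (f, g), t), ⟨⟨_, rfl⟩, trivial⟩⟩).trans (hI f g t)
  obtain ⟨π, hπ, hπG⟩ := exists_measure_integral_eq (G.comp (LinearMap.inl ℝ _ ℝ)) fun h hh => by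
    refine hGs _ ((hs _).2 ⟨le_rfl, fun p => ?_⟩)
    simp [ENNReal.ofReal_of_nonpos (neg_nonpos.2 (hh p))]
  refine ⟨π, ?_, ?_, fun h hh => ?_⟩
  · refine ext_of_forall_integral_eq_of_IsFiniteMeasure fun f => ?_
    rw [integral_map measurable_fst.aemeasurable f.continuous.aestronglyMeasurable]
    have h1 := hπG (J (f.toContinuousMap, 0))
    have h2 := hGI' f.toContinuousMap 0 0
    simpa [hJ, h2] using h1
  · refine ext_of_forall_integral_eq_of_IsFiniteMeasure fun f => ?_
    rw [integral_map measurable_snd.aemeasurable f.continuous.aestronglyMeasurable]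
    have h1 := hπG (J (0, f.toContinuousMap))
    have h2 := hGI' 0 f.toContinuousMap 0
    simpa [hJ, h2] using h1
  · have h1 : 0 ≤ G (-h, 1) := hGs _ ((hs _).2 ⟨zero_le_one, fun p => by simpa using hh p⟩)
    have h2 : G (0, 1) = M := by
      have := hGI' 0 0 1
      simpa [← Prod.zero_eq_mk] using this
    have h3 : ((-h, 1) : C(X × X, ℝ) × ℝ) = (0, 1) - (h, 0) := by simp
    rw [h3, map_sub, h2] at h1
    have h4 := hπG h
    simp only [LinearMap.comp_apply, LinearMap.inl_apply] at h4
    linarith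

theorem iSup_ofReal_neg_log_max (s : ℝ) :
    ⨆ k : ℕ, ENNReal.ofReal (-Real.log (max s (Real.exp (-k)))) =
      if 0 < s then ENNReal.ofReal (Real.log (1 / s)) else ⊤ := by
  split_ifs with hs
  · rw [one_div, Real.log_inv]
    refine le_antisymm (iSup_le fun k => ENNReal.ofReal_le_ofReal (neg_le_neg
      (Real.log_le_log hs (le_max_left _ _)))) ?_
    obtain ⟨k, hk⟩ := exists_nat_ge (-Real.log s)
    refine le_iSup_of_le k ?_
    rw [max_eq_left]
    rw [← Real.le_log_iff_exp_le hs]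
    linarith
  · refine ENNReal.eq_top_of_forall_nnreal_le fun r => ?_
    obtain ⟨k, hk⟩ := exists_nat_ge (r : ℝ)
    refine le_iSup_of_le k ?_
    rw [max_eq_right ((not_lt.1 hs).trans (Real.exp_pos _).le), Real.log_exp, neg_neg,
      ← ENNReal.ofReal_coe_nnreal]
    exact ENNReal.ofReal_le_ofReal hk

theorem exists_boundedContinuous_extension {E : Type*} [NormedAddCommGroup E] {S : Set E}
    [CompactSpace S] (hS : IsClosed S) (f : C(S, ℝ)) :
    ∃ F : BoundedContinuousFunction E ℝ, ∀ u : S, F u = f u := by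
  obtain ⟨F, -, hF⟩ :=
    (BoundedContinuousFunction.mkOfCompact f).exists_norm_eq_domRestrict_eq_of_closed hS
  exact ⟨F, fun u => DFunLike.congr_fun hF u⟩

theorem transportCost_le_of_integral_add_integral_le {n : ℕ}
    {ν₁ ν₂ : Measure (EuclideanSpace ℝ (Fin (n + 1)))}
    [IsProbabilityMeasure ν₁] [IsProbabilityMeasure ν₂]
    (hν₁ : ∀ᵐ x ∂ν₁, x ∈ Metric.sphere (0 : EuclideanSpace ℝ (Fin (n + 1))) 1)
    (hν₂ : ∀ᵐ x ∂ν₂, x ∈ Metric.sphere (0 : EuclideanSpace ℝ (Fin (n + 1))) 1)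
    {M : ℝ}
    (hdual : ∀ f g : BoundedContinuousFunction (EuclideanSpace ℝ (Fin (n + 1))) ℝ,
      (∀ u v : EuclideanSpace ℝ (Fin (n + 1)), ‖u‖ = 1 → ‖v‖ = 1 → 0 < ⟪u, v⟫ →
        f u + g v ≤ Real.log (1 / ⟪u, v⟫)) → ∫ u, f u ∂ν₁ + ∫ v, g v ∂ν₂ ≤ M) :
    transportCost sphereCost ν₁ ν₂ ≤ ENNReal.ofReal M := by
  set S := Metric.sphere (0 : EuclideanSpace ℝ (Fin (n + 1))) 1 with hS
  have hSm : MeasurableSet S := Metric.isClosed_sphere.measurableSet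
  have : CompactSpace S := isCompact_iff_compactSpace.1 (isCompact_sphere _ _)
  have hval : MeasurableEmbedding (Subtype.val : S → _) := .subtype_coe hSm
  have hmap : ∀ ν : Measure (EuclideanSpace ℝ (Fin (n + 1))), (∀ᵐ x ∂ν, x ∈ S) →
      (ν.comap (Subtype.val : S → _)).map Subtype.val = ν := fun ν h => by
    rw [map_comap_subtype_coe hSm, Measure.restrict_eq_self_of_ae_mem h]
  have hprob : ∀ ν : Measure (EuclideanSpace ℝ (Fin (n + 1))), IsProbabilityMeasure ν →
      (∀ᵐ x ∂ν, x ∈ S) → IsProbabilityMeasure (ν.comap (Subtype.val : S → _)) := fun ν hν h => by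
    refine (Measure.isProbabilityMeasure_map_iff measurable_subtype_coe.aemeasurable).1 ?_
    rwa [hmap ν h]
  have := hprob ν₁ inferInstance hν₁
  have := hprob ν₂ inferInstance hν₂
  have hle : ∀ u v : S, ⟪(u : EuclideanSpace ℝ (Fin (n + 1))), (v : EuclideanSpace ℝ (Fin (n + 1)))⟫
      ≤ 1 := fun u v => by
    have hu : ‖(u : EuclideanSpace ℝ (Fin (n + 1)))‖ = 1 := by simp
    have hv : ‖(v : EuclideanSpace ℝ (Fin (n + 1)))‖ = 1 := by simp
    simpa [hu, hv] using real_inner_le_norm (u : EuclideanSpace ℝ (Fin (n + 1))) v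
  obtain ⟨π, hπ₁, hπ₂, hπ⟩ := exists_coupling_integral_le
    (ν₁ := ν₁.comap (Subtype.val : S → _)) (ν₂ := ν₂.comap (Subtype.val : S → _))
    (fun p : S × S => sphereCost (p.1 : EuclideanSpace ℝ (Fin (n + 1))) p.2) fun f g hfg => by
      obtain ⟨f', hf⟩ := exists_boundedContinuous_extension Metric.isClosed_sphere f
      obtain ⟨g', hg⟩ := exists_boundedContinuous_extension Metric.isClosed_sphere g
      have h1 := hdual f' g' fun u v hu hv huv => by
        have h2 := hfg (⟨u, by simpa [hS] using hu⟩, ⟨v, by simpa [hS] using hv⟩)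
        have h3 : ⟪u, v⟫ ≤ 1 := hle ⟨u, by simpa [hS] using hu⟩ ⟨v, by simpa [hS] using hv⟩
        have h4 : 0 ≤ Real.log (1 / ⟪u, v⟫) := Real.log_nonneg (by rwa [le_div_iff₀ huv, one_mul])
        simp only [sphereCost, if_pos huv, ENNReal.ofReal_le_ofReal_iff h4, ← hf, ← hg] at h2
        exact h2
      rw [← hmap ν₁ hν₁, ← hmap ν₂ hν₂, hval.integral_map, hval.integral_map] at h1
      simpa only [hf, hg] using h1
  have hπf : IsProbabilityMeasure π :=
    (Measure.isProbabilityMeasure_map_iff measurable_fst.aemeasurable).1 (by rw [hπ₁]; infer_instance)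
  let K : ℕ → C(S × S, ℝ) := fun k =>
    ⟨fun p => -Real.log (max ⟪(p.1 : EuclideanSpace ℝ (Fin (n + 1))),
      (p.2 : EuclideanSpace ℝ (Fin (n + 1)))⟫ (Real.exp (-k))),
      (Continuous.log (by fun_prop) fun p => ((Real.exp_pos _).trans_le (le_max_right _ _)).ne').neg⟩
  have hK : ∀ p : S × S, sphereCost (p.1 : EuclideanSpace ℝ (Fin (n + 1))) p.2 =
      ⨆ k, ENNReal.ofReal (K k p) := fun p => (iSup_ofReal_neg_log_max _).symm
  have hK0 : ∀ k p, 0 ≤ K k p := fun k p => by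
    refine neg_nonneg.2 (Real.log_nonpos ((Real.exp_pos _).le.trans (le_max_right _ _)) ?_)
    exact max_le (hle _ _) (Real.exp_le_one_iff.2 (neg_nonpos.2 k.cast_nonneg))
  have hcost : ∫⁻ p : S × S, sphereCost (p.1 : EuclideanSpace ℝ (Fin (n + 1))) p.2 ∂π ≤
      ENNReal.ofReal M := by
    simp_rw [hK]
    rw [lintegral_iSup (fun k => (K k).continuous.measurable.ennreal_ofReal)]
    · refine iSup_le fun k => ?_
      have hi : Integrable (fun p => K k p) π :=
        (BoundedContinuousFunction.mkOfCompact (K k)).integrable π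
      rw [← ofReal_integral_eq_lintegral_ofReal hi (ae_of_all _ (hK0 k))]
      refine ENNReal.ofReal_le_ofReal (hπ (K k) fun p => ?_)
      rw [hK]
      exact le_iSup (fun k => ENNReal.ofReal (K k p)) k
    · intro k l hkl p
      refine ENNReal.ofReal_le_ofReal (neg_le_neg (Real.log_le_log
        ((Real.exp_pos _).trans_le (le_max_right _ _)) (max_le_max le_rfl ?_)))
      rw [Real.exp_le_exp, neg_le_neg_iff]
      exact_mod_cast hkl
  have hemb := hval.prodMap hval
  refine (iInf₂_le (π.map (Prod.map Subtype.val Subtype.val)) ⟨?_, ?_⟩).trans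
    ((hemb.lintegral_map _).trans_le hcost)
  · rw [Measure.map_map measurable_fst hemb.measurable, ← hmap ν₁ hν₁, ← hπ₁,
      Measure.map_map measurable_subtype_coe measurable_fst]
    rfl
  · rw [Measure.map_map measurable_snd hemb.measurable, ← hmap ν₂ hν₂, ← hπ₂,
      Measure.map_map measurable_subtype_coe measurable_snd]
    rfl

/-- Symmetrized transport-entropy inequality on the sphere: for all symmetric probability
measures `ν₁, ν₂` on `Sⁿ ⊂ ℝ^{n+1}` (encoded as measures on `ℝ^{n+1}` concentrated on the
unit sphere), `(n+1)·T_α(ν₁,ν₂) ≤ H(ν₁|σ) + H(ν₂|σ)`, where `σ` is the uniform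
(rotation-invariant) probability measure on `Sⁿ`. -/
theorem transport_entropy_sphere_symmetric (n : ℕ)
    (σ : Measure (EuclideanSpace ℝ (Fin (n + 1)))) [IsProbabilityMeasure σ]
    (hσsphere : σ (Metric.sphere (0 : EuclideanSpace ℝ (Fin (n + 1))) 1)ᶜ = 0)
    (hσinv : ∀ T : EuclideanSpace ℝ (Fin (n + 1)) ≃ₗᵢ[ℝ] EuclideanSpace ℝ (Fin (n + 1)),
      σ.map T = σ)
    (ν₁ ν₂ : Measure (EuclideanSpace ℝ (Fin (n + 1))))
    [IsProbabilityMeasure ν₁] [IsProbabilityMeasure ν₂]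
    (hν₁sphere : ν₁ (Metric.sphere (0 : EuclideanSpace ℝ (Fin (n + 1))) 1)ᶜ = 0)
    (hν₂sphere : ν₂ (Metric.sphere (0 : EuclideanSpace ℝ (Fin (n + 1))) 1)ᶜ = 0)
    (hν₁neg : ν₁.map (fun u => -u) = ν₁) (hν₂neg : ν₂.map (fun u => -u) = ν₂) :
    ((n : ℝ≥0∞) + 1) * transportCost sphereCost ν₁ ν₂
      ≤ relEnt ν₁ σ + relEnt ν₂ σ := by
  by_cases h₁ : ν₁ ≪ σ ∧ Integrable (llr ν₁ σ) ν₁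
  swap
  · simp [relEnt, h₁]
  by_cases h₂ : ν₂ ≪ σ ∧ Integrable (llr ν₂ σ) ν₂
  swap
  · simp [relEnt, h₂]
  have hH : ∀ ν : Measure (EuclideanSpace ℝ (Fin (n + 1))), IsProbabilityMeasure ν →
      ν ≪ σ ∧ Integrable (llr ν σ) ν → 0 ≤ ∫ x, llr ν σ x ∂ν := fun ν _ h => by
    simpa using InformationTheory.integral_llr_add_sub_measure_univ_nonneg h.1 h.2
  have hn : (0 : ℝ) < n + 1 := by positivity
  have hσ₁ : ∀ᵐ x ∂σ, ‖x‖ = 1 := by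
    filter_upwards [mem_ae_iff.2 hσsphere] with x hx using by simpa using hx
  have key := transportCost_le_of_integral_add_integral_le (ν₁ := ν₁) (ν₂ := ν₂)
    (mem_ae_iff.2 hν₁sphere) (mem_ae_iff.2 hν₂sphere)
    (M := (∫ x, llr ν₁ σ x ∂ν₁ + ∫ x, llr ν₂ σ x ∂ν₂) / (n + 1)) fun f g hfg => by
      rw [le_div_iff₀ hn, mul_comm]
      exact integral_add_integral_le_integral_llr hσ₁ hσinv hν₁neg hν₂neg h₁.1 h₁.2 h₂.1 h₂.2
        f g hfg
  rw [relEnt, relEnt, if_pos h₁, if_pos h₂, ← ENNReal.ofReal_add (hH ν₁ inferInstance h₁)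
    (hH ν₂ inferInstance h₂)]
  have hcast : (n : ℝ≥0∞) + 1 = ENNReal.ofReal (n + 1) := by
    rw [ENNReal.ofReal_add n.cast_nonneg zero_le_one]
    simp
  refine (mul_le_mul_right key _).trans_eq ?_
  rw [hcast, ← ENNReal.ofReal_mul hn.le, mul_div_cancel₀ _ hn.ne']
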